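/- There exist absolute constants c > 0, β > 0 and γ > 0 such that the following holds. Let F be a field and let P be a finite set of m points in F^2. If F has positive characteristic p, assume m ≤ c · p^{7/6}. Then at least one of the following is true: (i) some line in F^2 contains at least β·m points of P; or (ii) the number of distinct lines in F^2 that contain at least two points of P is at least γ · m^{8/7}. -/

import Mathlib

open scoped Classical

/-- A line in `F^2`: the set of points `(x, y)` with `α·x + β·y = γ`, where `(α, β) ≠ (0, 0)`. -/
def IsLine {F : Type*} [Field F] (ℓ : Set (F × F)) : Prop :=
  ∃ α β γ : F, (α, β) ≠ (0, 0) ∧ ℓ = {p : F × F | α * p.1 + β * p.2 = γ}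

/-- The chain rule for a derivation applied to the value of a multivariate polynomial. -/
theorem MvPolynomial.derivation_aeval {σ K A : Type*} [Fintype σ] [CommRing K] [CommRing A]
    [Algebra K A] (D : Derivation K A A) (g : σ → A) (f : MvPolynomial σ K) :
    D (MvPolynomial.aeval g f) =
      ∑ i, MvPolynomial.aeval g (MvPolynomial.pderiv i f) * D (g i) := by
  induction f using MvPolynomial.induction_on with
  | C a => simp
  | add p q hp hq => simp [hp, hq, add_mul, Finset.sum_add_distrib]
  | mul_X p i hp =>
    have h : ∀ j, MvPolynomial.aeval g (MvPolynomial.pderiv j (p * MvPolynomial.X i)) * D (g j) =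
        g i * (MvPolynomial.aeval g (MvPolynomial.pderiv j p) * D (g j)) +
          (if i = j then MvPolynomial.aeval g p * D (g j) else 0) := by
      intro j
      rw [MvPolynomial.pderiv_mul, MvPolynomial.pderiv_X]
      by_cases hij : i = j
      · subst hij
        simp
        ring
      · simp [hij]
        ring
    rw [Finset.sum_congr rfl fun j _ => h j, Finset.sum_add_distrib, ← Finset.mul_sum]
    simp only [map_mul, MvPolynomial.aeval_X, Derivation.leibniz, hp, smul_eq_mul,
      Finset.sum_ite_eq, Finset.mem_univ, if_true]
    ring

theorem MvPolynomial.totalDegree_pderiv_le {σ K : Type*} [CommRing K] (i : σ)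
    (f : MvPolynomial σ K) : (MvPolynomial.pderiv i f).totalDegree ≤ f.totalDegree - 1 := by
  rw [MvPolynomial.totalDegree]
  refine Finset.sup_le fun m hm => ?_
  rw [MvPolynomial.mem_support_iff, MvPolynomial.coeff_pderiv] at hm
  have h := MvPolynomial.le_totalDegree (MvPolynomial.mem_support_iff.mpr (left_ne_zero_of_mul hm))
  rw [Finsupp.sum_add_index' (by simp) (by simp), Finsupp.sum_single_index rfl] at h
  omega

theorem Matrix.totalDegree_det_le {σ K n : Type*} [CommRing K] [Fintype n] [DecidableEq n]
    (M : Matrix n n (MvPolynomial σ K)) (d : ℕ) (h : ∀ i j, (M i j).totalDegree ≤ d) :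
    M.det.totalDegree ≤ Fintype.card n * d := by
  rw [Matrix.det_apply]
  refine MvPolynomial.totalDegree_finsetSum_le fun s _ => ?_
  refine (MvPolynomial.totalDegree_smul_le _ _).trans ?_
  refine (MvPolynomial.totalDegree_finsetProd _ _).trans ?_
  refine (Finset.sum_le_sum fun i _ => h (s i) i).trans ?_
  simp

/-- Elimination of the variable `0` between an irreducible polynomial and a polynomial it does not
divide. -/
theorem MvPolynomial.exists_eliminant {n : ℕ} {K : Type*} [Field K]
    {f h : MvPolynomial (Fin (n + 1)) K} (hf : Irreducible f) (hfh : ¬ f ∣ h) :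
    ∃ (R : MvPolynomial (Fin n) K) (a b : MvPolynomial (Fin (n + 1)) K), R ≠ 0 ∧
      R.totalDegree ≤ (f.totalDegree + h.totalDegree) ^ 2 ∧
      MvPolynomial.rename Fin.succ R = f * a + h * b := by
  set e := MvPolynomial.finSuccEquiv K n
  have hren : ∀ R : MvPolynomial (Fin n) K,
      e (MvPolynomial.rename Fin.succ R) = Polynomial.C R := by
    intro R
    induction R using MvPolynomial.induction_on with
    | C a => simp [e, MvPolynomial.algebraMap_eq, MvPolynomial.finSuccEquiv_apply]
    | add p q hp hq => simp [hp, hq]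
    | mul_X p i hp => simp [hp, e, MvPolynomial.finSuccEquiv_X_succ]
  have hdeg : ∀ (g : MvPolynomial (Fin (n + 1)) K) (i : ℕ),
      ((e g).coeff i).totalDegree ≤ g.totalDegree := by
    intro g i
    by_cases hi : (e g).coeff i = 0
    · simp [hi]
    · exact (Nat.le_add_right _ _).trans
        (MvPolynomial.totalDegree_coeff_finSuccEquiv_add_le g i hi)
  have hnat : ∀ g : MvPolynomial (Fin (n + 1)) K, (e g).natDegree ≤ g.totalDegree := by
    intro g
    rw [MvPolynomial.natDegree_finSuccEquiv]
    exact MvPolynomial.degreeOf_le_totalDegree g 0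
  have hef : Irreducible (e f) := (MulEquiv.irreducible_iff e).mpr hf
  by_cases h0 : (e f).natDegree = 0
  · obtain ⟨R, hR⟩ := Polynomial.natDegree_eq_zero.mp h0
    refine ⟨R, 1, 0, ?_, ?_, ?_⟩
    · rintro rfl
      exact hef.ne_zero (by simp [← hR])
    · have h1 := hdeg f 0
      rw [← hR, Polynomial.coeff_C_zero] at h1
      exact h1.trans ((Nat.le_add_right _ _).trans (Nat.le_self_pow two_ne_zero _))
    · apply e.injective
      rw [hren, hR]
      simp
  · have hprim : (e f).IsPrimitive := hef.isPrimitive h0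
    set Q := FractionRing (MvPolynomial (Fin n) K)
    set ι := algebraMap (MvPolynomial (Fin n) K) Q
    have hinj : Function.Injective ι := IsFractionRing.injective _ _
    have hirr : Irreducible ((e f).map ι) :=
      hprim.irreducible_iff_irreducible_map_fraction_map.mp hef
    have hcop : IsCoprime ((e f).map ι) ((e h).map ι) := by
      rw [hirr.coprime_iff_not_dvd]
      intro hd
      have := hprim.dvd_of_fraction_map_dvd_fraction_map hd
      exact hfh ((map_dvd_iff e).mp this)
    have hres : ((e f).resultant (e h)) ≠ 0 := by
      intro h1
      have h2 := congrArg ι h1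
      rw [← Polynomial.resultant_map_map, map_zero,
        ← Polynomial.natDegree_map_eq_of_injective hinj,
        ← Polynomial.natDegree_map_eq_of_injective hinj (e h),
        Polynomial.resultant_eq_zero_iff] at h2
      exact h2.2 hcop
    obtain ⟨p, q, -, -, hpq⟩ := Polynomial.exists_mul_add_mul_eq_C_resultant (m := (e f).natDegree)
      (n := (e h).natDegree) (e f) (e h) le_rfl le_rfl (Or.inl h0)
    refine ⟨_, e.symm p, e.symm q, hres, ?_, ?_⟩
    · refine (Matrix.totalDegree_det_le _ (f.totalDegree + h.totalDegree) ?_).trans ?_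
      · intro i j
        simp only [Polynomial.sylvester, Matrix.of_apply]
        refine j.addCases (fun j => ?_) (fun j => ?_)
        · rw [Fin.addCases_left]
          split_ifs
          · exact (hdeg _ _).trans (Nat.le_add_left _ _)
          · simp
        · rw [Fin.addCases_right]
          split_ifs
          · exact (hdeg _ _).trans (Nat.le_add_right _ _)
          · simp
      · rw [Fintype.card_fin, sq]
        exact Nat.mul_le_mul_right _ (add_le_add (hnat f) (hnat h))
    · apply e.injective
      rw [hren, ← hpq]
      simp

/-- The polynomial whose vanishing on the zero set of `f` says that the sections of this zero set by
the planes parallel to the directions `0` and `j` have zero curvature. -/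
noncomputable def flexPoly {K : Type*} [Field K] (j : Fin 3) (f : MvPolynomial (Fin 3) K) :
    MvPolynomial (Fin 3) K :=
  MvPolynomial.pderiv j (MvPolynomial.pderiv j f) * MvPolynomial.pderiv 0 f ^ 2 -
    2 * MvPolynomial.pderiv j f * MvPolynomial.pderiv 0 f *
      MvPolynomial.pderiv 0 (MvPolynomial.pderiv j f) +
    MvPolynomial.pderiv j f ^ 2 * MvPolynomial.pderiv 0 (MvPolynomial.pderiv 0 f)

theorem MvPolynomial.pderiv_pderiv_swap {σ K : Type*} [CommRing K] (i j : σ)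
    (f : MvPolynomial σ K) : pderiv i (pderiv j f) = pderiv j (pderiv i f) := by
  ext m
  simp only [coeff_pderiv, add_right_comm m (Finsupp.single i 1) (Finsupp.single j 1)]
  by_cases h : i = j
  · subst h; rfl
  · simp [h, Ne.symm h]
    ring

theorem totalDegree_flexPoly_le {K : Type*} [Field K] (j : Fin 3) (f : MvPolynomial (Fin 3) K) :
    (flexPoly j f).totalDegree ≤ 3 * f.totalDegree := by
  have h1 : ∀ i, (MvPolynomial.pderiv i f).totalDegree ≤ f.totalDegree := fun i =>
    (MvPolynomial.totalDegree_pderiv_le i f).trans (Nat.sub_le _ _)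
  have h2 : ∀ i k, (MvPolynomial.pderiv i (MvPolynomial.pderiv k f)).totalDegree ≤
      f.totalDegree := fun i k =>
    ((MvPolynomial.totalDegree_pderiv_le i _).trans (Nat.sub_le _ _)).trans (h1 k)
  have hm : ∀ (a b : MvPolynomial (Fin 3) K) (m n : ℕ), a.totalDegree ≤ m → b.totalDegree ≤ n →
      (a * b).totalDegree ≤ m + n := fun a b m n ha hb =>
    (MvPolynomial.totalDegree_mul a b).trans (add_le_add ha hb)
  have h3 : (2 : MvPolynomial (Fin 3) K).totalDegree ≤ 0 :=
    (MvPolynomial.totalDegree_C (2 : K)).le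
  have e : 3 * f.totalDegree = f.totalDegree + (f.totalDegree + f.totalDegree) := by ring
  unfold flexPoly
  refine (MvPolynomial.totalDegree_add _ _).trans (max_le ?_ ?_)
  · refine (MvPolynomial.totalDegree_sub _ _).trans (max_le ?_ ?_)
    · rw [e, sq]
      exact hm _ _ _ _ (h2 _ _) (hm _ _ _ _ (h1 _) (h1 _))
    · have := hm _ _ _ _ (hm _ _ _ _ (hm _ _ _ _ h3 (h1 j)) (h1 0)) (h2 0 j)
      omega
  · rw [sq]
    have := hm _ _ _ _ (hm _ _ _ _ (h1 j) (h1 j)) (h2 0 0)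
    omega

theorem aeval_flexPoly {K A : Type*} [Field K] [CommRing A] [Algebra K A] (D : Derivation K A A)
    (g : Fin 3 → A) (f : MvPolynomial (Fin 3) K) (j : Fin 3) (hj : j ≠ 0) (h1 : D (g j) = 1)
    (h2 : D (D (g 0)) = 0) (h3 : ∀ i, i ≠ 0 → i ≠ j → D (g i) = 0) :
    MvPolynomial.aeval g (flexPoly j f) =
      MvPolynomial.aeval g (MvPolynomial.pderiv 0 f) ^ 2 * D (D (MvPolynomial.aeval g f)) +
      D (MvPolynomial.aeval g f) *
        (D (MvPolynomial.aeval g f) *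
            MvPolynomial.aeval g (MvPolynomial.pderiv 0 (MvPolynomial.pderiv 0 f)) -
          2 * MvPolynomial.aeval g (MvPolynomial.pderiv 0 f) *
          (MvPolynomial.aeval g (MvPolynomial.pderiv 0 (MvPolynomial.pderiv j f)) +
            D (g 0) *
              MvPolynomial.aeval g (MvPolynomial.pderiv 0 (MvPolynomial.pderiv 0 f)))) := by
  have hd : ∀ h : MvPolynomial (Fin 3) K, D (MvPolynomial.aeval g h) =
      MvPolynomial.aeval g (MvPolynomial.pderiv 0 h) * D (g 0) +
        MvPolynomial.aeval g (MvPolynomial.pderiv j h) := by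
    intro h
    rw [MvPolynomial.derivation_aeval, ← Finset.add_sum_erase _ _ (Finset.mem_univ 0),
      Finset.sum_eq_single j, h1, mul_one]
    · intro i hi hij
      rw [h3 i (Finset.ne_of_mem_erase hi) hij, mul_zero]
    · intro h
      exact absurd (Finset.mem_erase.mpr ⟨hj, Finset.mem_univ j⟩) h
  have hdd : D (D (MvPolynomial.aeval g f)) =
      MvPolynomial.aeval g (MvPolynomial.pderiv 0 (MvPolynomial.pderiv 0 f)) * D (g 0) ^ 2 +
      2 * MvPolynomial.aeval g (MvPolynomial.pderiv 0 (MvPolynomial.pderiv j f)) * D (g 0) +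
      MvPolynomial.aeval g (MvPolynomial.pderiv j (MvPolynomial.pderiv j f)) := by
    rw [hd f, map_add, Derivation.leibniz, h2, hd, hd, MvPolynomial.pderiv_pderiv_swap j 0]
    simp only [smul_eq_mul]
    ring
  rw [hdd, hd f]
  simp only [flexPoly, map_add, map_sub, map_mul, map_pow, map_ofNat]
  ring

theorem MvPolynomial.degreeOf_aeval_le {σ τ K : Type*} [Field K] (g : σ → MvPolynomial τ K)
    (i : τ) (hg : ∀ k, (g k).degreeOf i ≤ 1) (f : MvPolynomial σ K) :
    (aeval g f).degreeOf i ≤ f.totalDegree := by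
  rw [aeval_def, eval₂_eq]
  refine (degreeOf_sum_le _ _ _).trans (Finset.sup_le fun m hm => ?_)
  refine (degreeOf_mul_le _ _ _).trans ?_
  rw [algebraMap_eq, degreeOf_C, zero_add]
  refine (degreeOf_prod_le _ _ _).trans ?_
  refine (Finset.sum_le_sum fun k _ => (degreeOf_pow_le _ _ _).trans
    (Nat.mul_le_mul_left _ (hg k))).trans ?_
  simpa [Finsupp.sum] using le_totalDegree hm

theorem MvPolynomial.pderiv_mem_pow_idealOfVars {σ K : Type*} [CommRing K] (i : σ) (n : ℕ)
    {f : MvPolynomial σ K} (hf : f ∈ idealOfVars σ K ^ n) :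
    pderiv i f ∈ idealOfVars σ K ^ (n - 1) := by
  rw [mem_pow_idealOfVars_iff'] at hf ⊢
  intro m hm
  rw [coeff_pderiv, hf, zero_mul]
  rw [map_add, Finsupp.degree_single]
  omega

theorem exponent_le_one_of_dvd_flexPoly {K : Type*} [Field K] {f : MvPolynomial (Fin 3) K}
    {j : Fin 3} (hj : j ≠ 0) (hf : f ∣ flexPoly j f) (g : Fin 3 → MvPolynomial (Fin 2) K)
    (i : Fin 2) (h1 : MvPolynomial.pderiv i (g j) = 1)
    (h2 : MvPolynomial.pderiv i (MvPolynomial.pderiv i (g 0)) = 0)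
    (h3 : ∀ k, k ≠ 0 → k ≠ j → MvPolynomial.pderiv i (g k) = 0)
    (hg : ∀ k, (g k).degreeOf i ≤ 1)
    (hchar : ∀ n : ℕ, 0 < n → n ≤ f.totalDegree → (n : K) ≠ 0)
    (h0 : (MvPolynomial.aeval g (MvPolynomial.pderiv 0 f)).constantCoeff ≠ 0)
    (m : Fin 2 →₀ ℕ) (hm : (MvPolynomial.aeval g f).coeff m ≠ 0)
    (hmin : MvPolynomial.aeval g f ∈ MvPolynomial.idealOfVars (Fin 2) K ^ m.degree) :
    m i ≤ 1 := by
  by_contra! hlt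
  set Φ := MvPolynomial.aeval g f
  set E := MvPolynomial.aeval g (MvPolynomial.pderiv 0 f)
  set I := MvPolynomial.idealOfVars (Fin 2) K
  have hmi : m i ≤ m.degree := Finsupp.le_degree i m
  have hle : m i ≤ f.totalDegree :=
    (MvPolynomial.monomial_le_degreeOf i (MvPolynomial.mem_support_iff.mpr hm)).trans
      (MvPolynomial.degreeOf_aeval_le g i hg f)
  have hD : MvPolynomial.pderiv i Φ ∈ I ^ (m.degree - 1) :=
    MvPolynomial.pderiv_mem_pow_idealOfVars i _ hmin
  have hH : MvPolynomial.aeval g (flexPoly j f) ∈ I ^ (m.degree - 1) := by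
    obtain ⟨c, hc⟩ := hf
    rw [hc, map_mul]
    exact Ideal.mul_mem_right _ _ (Ideal.pow_le_pow_right (Nat.sub_le _ _) hmin)
  rw [aeval_flexPoly (MvPolynomial.pderiv i) g f j hj h1 h2 h3] at hH
  have hDD := (Ideal.add_mem_iff_left _ (Ideal.mul_mem_right _ _ hD)).mp hH
  have hEsub : E ^ 2 - MvPolynomial.C (E.constantCoeff ^ 2) ∈ I := by
    rw [← pow_one I, MvPolynomial.mem_pow_idealOfVars_iff']
    intro x hx
    have : x = 0 := by
      rw [← Finsupp.degree_eq_zero_iff]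
      omega
    subst this
    rw [← MvPolynomial.constantCoeff_eq]
    simp
  have hD2 : MvPolynomial.pderiv i (MvPolynomial.pderiv i Φ) ∈ I ^ (m.degree - 1 - 1) :=
    MvPolynomial.pderiv_mem_pow_idealOfVars i _ hD
  have hsub : (E ^ 2 - MvPolynomial.C (E.constantCoeff ^ 2)) *
      MvPolynomial.pderiv i (MvPolynomial.pderiv i Φ) ∈ I ^ (m.degree - 1) := by
    have := Ideal.mul_mem_mul hEsub hD2
    rwa [← pow_succ', Nat.sub_add_cancel (by omega)] at this
  have hfin := Ideal.sub_mem _ hDD hsub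
  rw [← sub_mul, sub_sub_cancel, MvPolynomial.mem_pow_idealOfVars_iff'] at hfin
  set x := m - Finsupp.single i 2
  have hx : m = x + Finsupp.single i 1 + Finsupp.single i 1 := by
    rw [add_assoc, ← Finsupp.single_add, tsub_add_cancel_of_le]
    rwa [Finsupp.single_le_iff]
  have hxd : m.degree = x.degree + 1 + 1 := by
    conv_lhs => rw [hx]
    simp
  have hxi : m i = x i + 2 := by
    conv_lhs => rw [hx]
    simp
  have hc := hfin x (by omega)
  rw [MvPolynomial.coeff_C_mul, MvPolynomial.coeff_pderiv, MvPolynomial.coeff_pderiv, ← hx] at hc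
  have e1 : ((x i : K) + 1) ≠ 0 := by exact_mod_cast hchar (x i + 1) (by omega) (by omega)
  have e2 : ((x + Finsupp.single i 1 : Fin 2 →₀ ℕ) i : K) + 1 ≠ 0 := by
    have := hchar (x i + 2) (by omega) (by omega)
    simp only [Finsupp.add_apply, Finsupp.single_eq_same]
    push_cast at this ⊢
    rwa [add_assoc, one_add_one_eq_two]
  exact (mul_ne_zero (pow_ne_zero 2 h0) (mul_ne_zero (mul_ne_zero hm e2) e1)) hc

theorem exists_quadric_of_aeval_eq_zero {K : Type*} [Field K] (f : MvPolynomial (Fin 3) K)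
    (P : Fin 3 → K) (α β γ : K)
    (h : MvPolynomial.aeval ![MvPolynomial.C (P 0) + MvPolynomial.C α * MvPolynomial.X 0 +
      MvPolynomial.C β * MvPolynomial.X 1 +
      MvPolynomial.C γ * MvPolynomial.X 0 * MvPolynomial.X 1,
      MvPolynomial.C (P 1) + MvPolynomial.X 0, MvPolynomial.C (P 2) + MvPolynomial.X 1] f =
        (0 : MvPolynomial (Fin 2) K)) :
    ∃ κ l μ ν : K, MvPolynomial.aeval ![MvPolynomial.C κ * MvPolynomial.X 0 * MvPolynomial.X 1 +
      MvPolynomial.C l * MvPolynomial.X 0 + MvPolynomial.C μ * MvPolynomial.X 1 +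
      MvPolynomial.C ν, MvPolynomial.X 0, MvPolynomial.X 1] f = (0 : MvPolynomial (Fin 2) K) := by
  refine ⟨γ, α - γ * P 2, β - γ * P 1, P 0 - α * P 1 - β * P 2 + γ * P 1 * P 2, ?_⟩
  have htr := congrArg (MvPolynomial.aeval (R := K)
    (![MvPolynomial.X 0 - MvPolynomial.C (P 1), MvPolynomial.X 1 - MvPolynomial.C (P 2)] :
      Fin 2 → MvPolynomial (Fin 2) K)) h
  rw [map_zero, ← AlgHom.comp_apply, MvPolynomial.comp_aeval] at htr
  rw [← htr]
  congr 2
  funext i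
  fin_cases i
  · simp only [Fin.zero_eta, Matrix.cons_val_zero, map_add, map_mul, map_sub,
      MvPolynomial.aeval_X, Matrix.cons_val_one, MvPolynomial.aeval_C,
      MvPolynomial.algebraMap_eq]
    ring
  · simp [MvPolynomial.algebraMap_eq]
  · simp [MvPolynomial.algebraMap_eq]

theorem exists_quadric_of_dvd_flexPoly {K : Type*} [Field K] {f : MvPolynomial (Fin 3) K}
    (hf1 : f ∣ flexPoly 1 f) (hf2 : f ∣ flexPoly 2 f)
    (hchar : ∀ n : ℕ, 0 < n → n ≤ f.totalDegree → (n : K) ≠ 0) (P : Fin 3 → K)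
    (hP : MvPolynomial.eval P f = 0) (hP0 : MvPolynomial.eval P (MvPolynomial.pderiv 0 f) ≠ 0) :
    ∃ κ l μ ν : K, MvPolynomial.aeval ![MvPolynomial.C κ * MvPolynomial.X 0 * MvPolynomial.X 1 +
      MvPolynomial.C l * MvPolynomial.X 0 + MvPolynomial.C μ * MvPolynomial.X 1 +
      MvPolynomial.C ν, MvPolynomial.X 0, MvPolynomial.X 1] f = (0 : MvPolynomial (Fin 2) K) := by
  set f0 := MvPolynomial.eval P (MvPolynomial.pderiv 0 f) with hf0
  set α : K := - MvPolynomial.eval P (MvPolynomial.pderiv 1 f) / f0 with hα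
  set β : K := - MvPolynomial.eval P (MvPolynomial.pderiv 2 f) / f0 with hβ
  set f00 := MvPolynomial.eval P (MvPolynomial.pderiv 0 (MvPolynomial.pderiv 0 f)) with hf00
  set f01 := MvPolynomial.eval P (MvPolynomial.pderiv 1 (MvPolynomial.pderiv 0 f)) with hf01
  set f02 := MvPolynomial.eval P (MvPolynomial.pderiv 0 (MvPolynomial.pderiv 2 f)) with hf02
  set f12 := MvPolynomial.eval P (MvPolynomial.pderiv 1 (MvPolynomial.pderiv 2 f)) with hf12
  set γ : K := - ((f00 * α + f01) * β + f02 * α + f12) / f0 with hγ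
  set g : Fin 3 → MvPolynomial (Fin 2) K :=
    ![MvPolynomial.C (P 0) + MvPolynomial.C α * MvPolynomial.X 0 +
      MvPolynomial.C β * MvPolynomial.X 1 +
      MvPolynomial.C γ * MvPolynomial.X 0 * MvPolynomial.X 1,
      MvPolynomial.C (P 1) + MvPolynomial.X 0, MvPolynomial.C (P 2) + MvPolynomial.X 1] with hg
  set Φ := MvPolynomial.aeval g f with hΦ
  have hcc : ∀ h : MvPolynomial (Fin 3) K,
      (MvPolynomial.aeval g h).constantCoeff = MvPolynomial.eval P h := by
    intro h
    have : (MvPolynomial.constantCoeff.comp (MvPolynomial.aeval g).toRingHom) =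
        MvPolynomial.eval P := by
      apply MvPolynomial.ringHom_ext
      · intro r; simp
      · intro i
        fin_cases i <;> simp [hg]
    exact DFunLike.congr_fun this h
  have g00 : MvPolynomial.pderiv 0 (g 0) =
      MvPolynomial.C α + MvPolynomial.C γ * MvPolynomial.X 1 := by
    simp [hg, Derivation.leibniz, mul_comm]
  have g01 : MvPolynomial.pderiv 1 (g 0) =
      MvPolynomial.C β + MvPolynomial.C γ * MvPolynomial.X 0 := by
    simp [hg, Derivation.leibniz]
  have g10 : MvPolynomial.pderiv 0 (g 1) = 1 := by simp [hg]
  have g11 : MvPolynomial.pderiv 1 (g 1) = 0 := by simp [hg]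
  have g20 : MvPolynomial.pderiv 0 (g 2) = 0 := by simp [hg]
  have g21 : MvPolynomial.pderiv 1 (g 2) = 1 := by simp [hg]
  have hd0 : ∀ h : MvPolynomial (Fin 3) K, MvPolynomial.pderiv 0 (MvPolynomial.aeval g h) =
      MvPolynomial.aeval g (MvPolynomial.pderiv 0 h) *
        (MvPolynomial.C α + MvPolynomial.C γ * MvPolynomial.X 1) +
      MvPolynomial.aeval g (MvPolynomial.pderiv 1 h) := by
    intro h
    rw [MvPolynomial.derivation_aeval, Fin.sum_univ_three, g00, g10, g20]
    ring
  have hd1 : ∀ h : MvPolynomial (Fin 3) K, MvPolynomial.pderiv 1 (MvPolynomial.aeval g h) =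
      MvPolynomial.aeval g (MvPolynomial.pderiv 0 h) *
        (MvPolynomial.C β + MvPolynomial.C γ * MvPolynomial.X 0) +
      MvPolynomial.aeval g (MvPolynomial.pderiv 2 h) := by
    intro h
    rw [MvPolynomial.derivation_aeval, Fin.sum_univ_three, g01, g11, g21]
    ring
  have hdeg : ∀ (k : Fin 3) (i : Fin 2), (g k).degreeOf i ≤ 1 := by
    have hC : ∀ (a : K) (i : Fin 2), (MvPolynomial.C a).degreeOf i = 0 := fun a i =>
      MvPolynomial.degreeOf_C a i
    have hCX : ∀ (a : K) (i j : Fin 2),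
        (MvPolynomial.C a * MvPolynomial.X j).degreeOf i ≤ if i = j then 1 else 0 := by
      intro a i j
      refine (MvPolynomial.degreeOf_mul_le _ _ _).trans ?_
      rw [hC, MvPolynomial.degreeOf_X, zero_add]
    have hX : ∀ (i j : Fin 2),
        (MvPolynomial.X j : MvPolynomial (Fin 2) K).degreeOf i ≤ if i = j then 1 else 0 := by
      intro i j
      rw [MvPolynomial.degreeOf_X]
    have hle : ∀ i j : Fin 2, (if i = j then 1 else 0) ≤ 1 := by
      intro i j; split_ifs <;> simp
    intro k i
    fin_cases k
    · refine (MvPolynomial.degreeOf_add_le _ _ _).trans (max_le ?_ ?_)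
      · refine (MvPolynomial.degreeOf_add_le _ _ _).trans (max_le ?_ ((hCX _ _ _).trans (hle _ _)))
        refine (MvPolynomial.degreeOf_add_le _ _ _).trans
          (max_le ?_ ((hCX _ _ _).trans (hle _ _)))
        simp [hC]
      · refine (MvPolynomial.degreeOf_mul_le _ _ _).trans
          ((add_le_add (hCX _ _ _) (hX _ _)).trans ?_)
        fin_cases i <;> simp
    · refine (MvPolynomial.degreeOf_add_le _ _ _).trans (max_le (by simp [hC]) ?_)
      exact (hX _ _).trans (hle _ _)
    · refine (MvPolynomial.degreeOf_add_le _ _ _).trans (max_le (by simp [hC]) ?_)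
      exact (hX _ _).trans (hle _ _)
  have hc00 : MvPolynomial.coeff 0 Φ = 0 := by
    rw [← MvPolynomial.constantCoeff_eq, hΦ, hcc, hP]
  have hc10 : MvPolynomial.coeff (Finsupp.single 0 1) Φ = 0 := by
    have h1 : (MvPolynomial.pderiv 0 Φ).constantCoeff = 0 := by
      rw [hΦ, hd0]
      simp only [map_add, map_mul, hcc, MvPolynomial.constantCoeff_C,
        MvPolynomial.constantCoeff_X, mul_zero, add_zero, ← hf0, hα]
      field_simp
      ring
    rw [MvPolynomial.constantCoeff_eq, MvPolynomial.coeff_pderiv] at h1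
    simpa using h1
  have hc01 : MvPolynomial.coeff (Finsupp.single 1 1) Φ = 0 := by
    have h1 : (MvPolynomial.pderiv 1 Φ).constantCoeff = 0 := by
      rw [hΦ, hd1]
      simp only [map_add, map_mul, hcc, MvPolynomial.constantCoeff_C,
        MvPolynomial.constantCoeff_X, mul_zero, add_zero, ← hf0, hβ]
      field_simp
      ring
    rw [MvPolynomial.constantCoeff_eq, MvPolynomial.coeff_pderiv] at h1
    simpa using h1
  have hc11 : MvPolynomial.coeff (Finsupp.single 0 1 + Finsupp.single 1 1) Φ = 0 := by
    have h1 : (MvPolynomial.pderiv 0 (MvPolynomial.pderiv 1 Φ)).constantCoeff = 0 := by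
      rw [hΦ, hd1, map_add, Derivation.leibniz, hd0, hd0]
      simp only [smul_eq_mul, map_add, map_mul, hcc, MvPolynomial.constantCoeff_C,
        MvPolynomial.constantCoeff_X, mul_zero, add_zero, ← hf0, Derivation.leibniz,
        MvPolynomial.pderiv_C, MvPolynomial.pderiv_X_self, mul_one, zero_add,
        ← hf00, ← hf01, ← hf02, ← hf12]
      have : f0 * γ = - ((f00 * α + f01) * β + f02 * α + f12) := by
        rw [hγ]
        field_simp
      rw [this]
      ring
    rw [MvPolynomial.constantCoeff_eq, MvPolynomial.coeff_pderiv, MvPolynomial.coeff_pderiv] at h1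
    simpa using h1
  have hΦ0 : Φ = 0 := by
    by_contra hne
    obtain ⟨m, hm, hmin⟩ := Finset.exists_min_image Φ.support (fun m => m.degree)
      (MvPolynomial.support_nonempty.mpr hne)
    rw [MvPolynomial.mem_support_iff] at hm
    have hmem : Φ ∈ MvPolynomial.idealOfVars (Fin 2) K ^ m.degree := by
      rw [MvPolynomial.mem_pow_idealOfVars_iff']
      intro x hx
      by_contra hx0
      exact absurd (hmin x (MvPolynomial.mem_support_iff.mpr hx0)) (not_le.mpr hx)
    have hE : (MvPolynomial.aeval g (MvPolynomial.pderiv 0 f)).constantCoeff ≠ 0 := by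
      rwa [hcc]
    have hm0 : m 0 ≤ 1 := by
      refine exponent_le_one_of_dvd_flexPoly (j := 1) (by decide) hf1 g 0 g10 ?_ ?_
        (fun k => hdeg k 0) hchar hE m hm hmem
      · rw [g00]; simp
      · intro k hk0 hk1
        have : k = 2 := by omega
        rw [this, g20]
    have hm1 : m 1 ≤ 1 := by
      refine exponent_le_one_of_dvd_flexPoly (j := 2) (by decide) hf2 g 1 g21 ?_ ?_
        (fun k => hdeg k 1) hchar hE m hm hmem
      · rw [g01]; simp
      · intro k hk0 hk1
        have : k = 1 := by omega
        rw [this, g11]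
    have hmd : m = Finsupp.single 0 (m 0) + Finsupp.single 1 (m 1) := by
      ext i
      fin_cases i <;> simp
    rw [hmd] at hm
    rcases Nat.le_one_iff_eq_zero_or_eq_one.mp hm0 with h | h <;>
    rcases Nat.le_one_iff_eq_zero_or_eq_one.mp hm1 with h' | h' <;>
    · rw [h, h'] at hm
      simp_all
  exact exists_quadric_of_aeval_eq_zero f P α β γ hΦ0

noncomputable def hLine {K : Type*} [Field K] (p : K × K × K) :
    MvPolynomial (Fin 3) K →ₐ[K] Polynomial K :=
  MvPolynomial.aeval ![Polynomial.C p.1 * Polynomial.X - Polynomial.C p.2.2, Polynomial.X,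
    Polynomial.C p.2.1]

noncomputable def vLine {K : Type*} [Field K] (q : K × K × K) :
    MvPolynomial (Fin 3) K →ₐ[K] Polynomial K :=
  MvPolynomial.aeval ![Polynomial.C q.2.1 * Polynomial.X - Polynomial.C q.2.2, Polynomial.C q.1,
    Polynomial.X]

def Meet {K : Type*} [Field K] (p q : K × K × K) : Prop :=
  q.1 * p.1 + q.2.2 = p.2.1 * q.2.1 + p.2.2

theorem eval_hLine {K : Type*} [Field K] (p : K × K × K) (f : MvPolynomial (Fin 3) K) (x : K) :
    (hLine p f).eval x = MvPolynomial.eval ![p.1 * x - p.2.2, x, p.2.1] f := by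
  have : (Polynomial.aeval x).comp (hLine p) =
      MvPolynomial.aeval (R := K) ![p.1 * x - p.2.2, x, p.2.1] := by
    apply MvPolynomial.algHom_ext
    intro i
    fin_cases i <;> simp [hLine]
  have h := DFunLike.congr_fun this f
  simpa [Polynomial.aeval_def, MvPolynomial.aeval_def, Polynomial.eval₂_id,
    MvPolynomial.eval₂_id] using h

theorem eval_vLine {K : Type*} [Field K] (q : K × K × K) (f : MvPolynomial (Fin 3) K) (x : K) :
    (vLine q f).eval x = MvPolynomial.eval ![q.2.1 * x - q.2.2, q.1, x] f := by
  have : (Polynomial.aeval x).comp (vLine q) =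
      MvPolynomial.aeval (R := K) ![q.2.1 * x - q.2.2, q.1, x] := by
    apply MvPolynomial.algHom_ext
    intro i
    fin_cases i <;> simp [vLine]
  have h := DFunLike.congr_fun this f
  simpa [Polynomial.aeval_def, MvPolynomial.aeval_def, Polynomial.eval₂_id,
    MvPolynomial.eval₂_id] using h

theorem Meet.eval_eq {K : Type*} [Field K] {p q : K × K × K} (h : Meet p q)
    (f : MvPolynomial (Fin 3) K) : (hLine p f).eval q.1 = (vLine q f).eval p.2.1 := by
  rw [eval_hLine, eval_vLine]
  have : p.1 * q.1 - p.2.2 = q.2.1 * p.2.1 - q.2.2 := by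
    unfold Meet at h
    linear_combination h
  rw [this]

theorem natDegree_hLine_le {K : Type*} [Field K] (p : K × K × K) (f : MvPolynomial (Fin 3) K) :
    (hLine p f).natDegree ≤ f.totalDegree := by
  have := MvPolynomial.aeval_natDegree_le (R := K) (m := f.totalDegree) f le_rfl
    ![Polynomial.C p.1 * Polynomial.X - Polynomial.C p.2.2, Polynomial.X,
    Polynomial.C p.2.1] (n := 1) (by
      intro i
      fin_cases i
      · simp only [Fin.zero_eta, Matrix.cons_val_zero]
        compute_degree
      · simp
      · simp)
  simpa [hLine] using this

theorem natDegree_vLine_le {K : Type*} [Field K] (q : K × K × K) (f : MvPolynomial (Fin 3) K) :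
    (vLine q f).natDegree ≤ f.totalDegree := by
  have := MvPolynomial.aeval_natDegree_le (R := K) (m := f.totalDegree) f le_rfl
    ![Polynomial.C q.2.1 * Polynomial.X - Polynomial.C q.2.2, Polynomial.C q.1,
    Polynomial.X] (n := 1) (by
      intro i
      fin_cases i
      · simp only [Fin.zero_eta, Matrix.cons_val_zero]
        compute_degree
      · simp
      · simp)
  simpa [vLine] using this

theorem hLine_flexPoly_eq_zero {K : Type*} [Field K] {p : K × K × K}
    {f : MvPolynomial (Fin 3) K} (h : hLine p f = 0) : hLine p (flexPoly 1 f) = 0 := by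
  unfold hLine at h ⊢
  rw [aeval_flexPoly Polynomial.derivative' _ f 1 (by decide), h]
  · simp
  · simp
  · simp
  · intro i hi0 hi1
    have : i = 2 := by omega
    subst this
    simp

theorem vLine_flexPoly_eq_zero {K : Type*} [Field K] {q : K × K × K}
    {f : MvPolynomial (Fin 3) K} (h : vLine q f = 0) : vLine q (flexPoly 2 f) = 0 := by
  unfold vLine at h ⊢
  rw [aeval_flexPoly Polynomial.derivative' _ f 2 (by decide), h]
  · simp
  · simp
  · simp
  · intro i hi0 hi1
    have : i = 1 := by omega
    subst this
    simp

noncomputable def meetCount {K : Type*} [Field K] (A B : Finset (K × K × K)) : ℕ :=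
  ((A ×ˢ B).filter fun z => Meet z.1 z.2).card

theorem meetCount_eq_sum_left {K : Type*} [Field K] (A B : Finset (K × K × K)) :
    meetCount A B = ∑ p ∈ A, (B.filter fun q => Meet p q).card := by
  simp only [meetCount, Finset.card_filter, Finset.sum_product]

theorem meetCount_eq_sum_right {K : Type*} [Field K] (A B : Finset (K × K × K)) :
    meetCount A B = ∑ q ∈ B, (A.filter fun p => Meet p q).card := by
  simp only [meetCount, Finset.card_filter, Finset.sum_product_right]

theorem meetCount_le_mul {K : Type*} [Field K] (A B : Finset (K × K × K)) :
    meetCount A B ≤ A.card * B.card :=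
  (Finset.card_filter_le _ _).trans (Finset.card_product _ _).le

theorem meetCount_filter_left {K : Type*} [Field K] (A B : Finset (K × K × K))
    (φ : K × K × K → Prop) [DecidablePred φ] :
    meetCount A B = meetCount (A.filter φ) B + meetCount (A.filter fun p => ¬ φ p) B := by
  simp only [meetCount_eq_sum_left]
  rw [Finset.sum_filter_add_sum_filter_not]

theorem meetCount_filter_right {K : Type*} [Field K] (A B : Finset (K × K × K))
    (φ : K × K × K → Prop) [DecidablePred φ] :
    meetCount A B = meetCount A (B.filter φ) + meetCount A (B.filter fun p => ¬ φ p) := by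
  simp only [meetCount_eq_sum_right]
  rw [Finset.sum_filter_add_sum_filter_not]

theorem meetCount_le_of_hLine_ne_zero {K : Type*} [Field K] {A B : Finset (K × K × K)}
    {h : MvPolynomial (Fin 3) K} (hA : ∀ p ∈ A, hLine p h ≠ 0) (hB : ∀ q ∈ B, vLine q h = 0)
    (hinj : Set.InjOn (fun q : K × K × K => q.1) B) :
    meetCount A B ≤ A.card * h.totalDegree := by
  rw [meetCount_eq_sum_left]
  refine Finset.sum_le_card_nsmul _ _ _ fun p hp => ?_
  have hsub : (B.filter fun q => Meet p q).image (fun q => q.1) ⊆ (hLine p h).roots.toFinset := by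
    intro s hs
    obtain ⟨q, hq, rfl⟩ := Finset.mem_image.mp hs
    rw [Finset.mem_filter] at hq
    rw [Multiset.mem_toFinset, Polynomial.mem_roots (hA p hp), Polynomial.IsRoot.def,
      hq.2.eval_eq, hB q hq.1, Polynomial.eval_zero]
  have hc := Finset.card_le_card hsub
  rw [Finset.card_image_of_injOn (hinj.mono (by
    intro q hq
    exact (Finset.mem_filter.mp hq).1))] at hc
  exact hc.trans ((Multiset.toFinset_card_le _).trans ((Polynomial.card_roots' _).trans
    (natDegree_hLine_le _ _)))

theorem meetCount_le_of_vLine_ne_zero {K : Type*} [Field K] {A B : Finset (K × K × K)}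
    {h : MvPolynomial (Fin 3) K} (hA : ∀ p ∈ A, hLine p h = 0) (hB : ∀ q ∈ B, vLine q h ≠ 0)
    (hinj : Set.InjOn (fun p : K × K × K => p.2.1) A) :
    meetCount A B ≤ B.card * h.totalDegree := by
  rw [meetCount_eq_sum_right]
  refine Finset.sum_le_card_nsmul _ _ _ fun q hq => ?_
  have hsub : (A.filter fun p => Meet p q).image (fun p => p.2.1) ⊆
      (vLine q h).roots.toFinset := by
    intro s hs
    obtain ⟨p, hp, rfl⟩ := Finset.mem_image.mp hs
    rw [Finset.mem_filter] at hp
    rw [Multiset.mem_toFinset, Polynomial.mem_roots (hB q hq), Polynomial.IsRoot.def,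
      ← hp.2.eval_eq, hA p hp.1, Polynomial.eval_zero]
  have hc := Finset.card_le_card hsub
  rw [Finset.card_image_of_injOn (hinj.mono (by
    intro q hq
    exact (Finset.mem_filter.mp hq).1))] at hc
  exact hc.trans ((Multiset.toFinset_card_le _).trans ((Polynomial.card_roots' _).trans
    (natDegree_vLine_le _ _)))

theorem MvPolynomial.exists_rename_succ_of_pderiv_eq_zero {K : Type*} [Field K] {n : ℕ}
    {f : MvPolynomial (Fin (n + 1)) K} (hf : pderiv 0 f = 0)
    (hchar : ∀ i : ℕ, 0 < i → i ≤ f.totalDegree → (i : K) ≠ 0) :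
    ∃ R : MvPolynomial (Fin n) K, R.totalDegree ≤ f.totalDegree ∧ rename Fin.succ R = f := by
  obtain ⟨R, hR⟩ := exists_rename_eq_of_vars_subset_range f (Fin.succ : Fin n → Fin (n + 1))
    (Fin.succ_injective n) (by
      intro i hi
      rw [Fin.range_succ]
      rintro rfl
      obtain ⟨m, hm, hmi⟩ := (mem_vars_iff_mem_support 0).mp hi
      have hpos : 0 < m 0 := Nat.pos_of_ne_zero (Finsupp.mem_support_iff.mp hmi)
      have hle : m 0 ≤ f.totalDegree :=
        (monomial_le_degreeOf 0 hm).trans (degreeOf_le_totalDegree f 0)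
      have h := coeff_pderiv (i := 0) f (m - Finsupp.single 0 1)
      rw [hf, coeff_zero, tsub_add_cancel_of_le (by rwa [Finsupp.single_le_iff])] at h
      have hcast : (((m - Finsupp.single 0 1 : Fin (n + 1) →₀ ℕ) 0 : ℕ) : K) + 1 = (m 0 : ℕ) := by
        rw [Finsupp.tsub_apply, Finsupp.single_eq_same, ← Nat.cast_succ,
          Nat.succ_eq_add_one, Nat.sub_add_cancel hpos]
      rw [hcast] at h
      exact mul_ne_zero (mem_support_iff.mp hm) (hchar _ hpos hle) h.symm)
  refine ⟨R, ?_, hR⟩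
  cases n with
  | zero =>
    rw [eq_C_of_isEmpty R, totalDegree_C]
    exact Nat.zero_le _
  | succ n =>
    have h := totalDegree_rename_le (Fin.cases 0 id : Fin (n + 2) → Fin (n + 1)) f
    rw [← hR, rename_rename] at h
    have hid : (Fin.cases 0 id : Fin (n + 2) → Fin (n + 1)) ∘ Fin.succ = id := by
      funext i; simp
    rwa [hid, rename_id_apply, hR] at h

theorem card_le_of_hLine_rename_eq_zero {K : Type*} [Field K] [Infinite K]
    {R : MvPolynomial (Fin 2) K} (hR : R ≠ 0) (A : Finset (K × K × K))
    (hA : ∀ p ∈ A, hLine p (MvPolynomial.rename Fin.succ R) = 0)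
    (hinj : Set.InjOn (fun p : K × K × K => p.2.1) A) : A.card ≤ R.totalDegree := by
  obtain ⟨z, hz⟩ : ∃ z, MvPolynomial.eval z R ≠ 0 := by
    by_contra! h
    exact hR (MvPolynomial.funext fun x => by rw [h, map_zero])
  set g : Polynomial K := MvPolynomial.aeval ![Polynomial.C (z 0), Polynomial.X] R with hg
  have heval : ∀ x, g.eval x = MvPolynomial.eval ![z 0, x] R := by
    intro x
    have : (Polynomial.aeval x).comp (MvPolynomial.aeval ![Polynomial.C (z 0), Polynomial.X]) =
        MvPolynomial.aeval (R := K) ![z 0, x] := by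
      apply MvPolynomial.algHom_ext
      intro i
      fin_cases i <;> simp
    have h := DFunLike.congr_fun this R
    simpa [hg, Polynomial.aeval_def, MvPolynomial.aeval_def, Polynomial.eval₂_id,
      MvPolynomial.eval₂_id] using h
  have hg0 : g ≠ 0 := by
    intro h0
    have := heval (z 1)
    rw [h0, Polynomial.eval_zero] at this
    apply hz
    rw [this]
    congr 2
    funext i
    fin_cases i <;> rfl
  have hdeg : g.natDegree ≤ R.totalDegree := by
    have := MvPolynomial.aeval_natDegree_le (R := K) (m := R.totalDegree) R le_rfl
      ![Polynomial.C (z 0), Polynomial.X] (n := 1) (by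
        intro i
        fin_cases i <;> simp)
    simpa using this
  have hsub : A.image (fun p => p.2.1) ⊆ g.roots.toFinset := by
    intro s hs
    obtain ⟨p, hp, rfl⟩ := Finset.mem_image.mp hs
    rw [Multiset.mem_toFinset, Polynomial.mem_roots hg0, Polynomial.IsRoot.def, heval]
    have := eval_hLine p (MvPolynomial.rename Fin.succ R) (z 0)
    rw [hA p hp, Polynomial.eval_zero, MvPolynomial.eval_rename] at this
    exact this.symm
  have hc := Finset.card_le_card hsub
  rw [Finset.card_image_of_injOn hinj] at hc
  exact hc.trans ((Multiset.toFinset_card_le _).trans ((Polynomial.card_roots' _).trans hdeg))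

theorem card_le_of_vLine_rename_eq_zero {K : Type*} [Field K] [Infinite K]
    {R : MvPolynomial (Fin 2) K} (hR : R ≠ 0) (B : Finset (K × K × K))
    (hB : ∀ q ∈ B, vLine q (MvPolynomial.rename Fin.succ R) = 0)
    (hinj : Set.InjOn (fun q : K × K × K => q.1) B) : B.card ≤ R.totalDegree := by
  obtain ⟨z, hz⟩ : ∃ z, MvPolynomial.eval z R ≠ 0 := by
    by_contra! h
    exact hR (MvPolynomial.funext fun x => by rw [h, map_zero])
  set g : Polynomial K := MvPolynomial.aeval ![Polynomial.X, Polynomial.C (z 1)] R with hg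
  have heval : ∀ x, g.eval x = MvPolynomial.eval ![x, z 1] R := by
    intro x
    have : (Polynomial.aeval x).comp (MvPolynomial.aeval ![Polynomial.X, Polynomial.C (z 1)]) =
        MvPolynomial.aeval (R := K) ![x, z 1] := by
      apply MvPolynomial.algHom_ext
      intro i
      fin_cases i <;> simp
    have h := DFunLike.congr_fun this R
    simpa [hg, Polynomial.aeval_def, MvPolynomial.aeval_def, Polynomial.eval₂_id,
      MvPolynomial.eval₂_id] using h
  have hg0 : g ≠ 0 := by
    intro h0
    have := heval (z 0)
    rw [h0, Polynomial.eval_zero] at this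
    apply hz
    rw [this]
    congr 2
    funext i
    fin_cases i <;> rfl
  have hdeg : g.natDegree ≤ R.totalDegree := by
    have := MvPolynomial.aeval_natDegree_le (R := K) (m := R.totalDegree) R le_rfl
      ![Polynomial.X, Polynomial.C (z 1)] (n := 1) (by
        intro i
        fin_cases i <;> simp)
    simpa using this
  have hsub : B.image (fun q => q.1) ⊆ g.roots.toFinset := by
    intro s hs
    obtain ⟨q, hq, rfl⟩ := Finset.mem_image.mp hs
    rw [Multiset.mem_toFinset, Polynomial.mem_roots hg0, Polynomial.IsRoot.def, heval]
    have := eval_vLine q (MvPolynomial.rename Fin.succ R) (z 1)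
    rw [hB q hq, Polynomial.eval_zero, MvPolynomial.eval_rename] at this
    exact this.symm
  have hc := Finset.card_le_card hsub
  rw [Finset.card_image_of_injOn hinj] at hc
  exact hc.trans ((Multiset.toFinset_card_le _).trans ((Polynomial.card_roots' _).trans hdeg))

theorem card_le_of_hLine_eq_zero {K : Type*} [Field K] [Infinite K]
    {f h : MvPolynomial (Fin 3) K} (hf : Irreducible f) (hfh : ¬ f ∣ h)
    (hdeg : h.totalDegree ≤ 3 * f.totalDegree) {A : Finset (K × K × K)}
    (hA : ∀ p ∈ A, hLine p f = 0) (hA' : ∀ p ∈ A, hLine p h = 0)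
    (hinj : Set.InjOn (fun p : K × K × K => p.2.1) A) : A.card ≤ 16 * f.totalDegree ^ 2 := by
  obtain ⟨R, a, b, hR0, hRd, hR⟩ := MvPolynomial.exists_eliminant hf hfh
  refine (card_le_of_hLine_rename_eq_zero hR0 A (fun p hp => ?_) hinj).trans (hRd.trans ?_)
  · rw [hR, map_add, map_mul, map_mul, hA p hp, hA' p hp, zero_mul, zero_mul, add_zero]
  · calc _ ≤ (f.totalDegree + 3 * f.totalDegree) ^ 2 := by gcongr
      _ = _ := by ring

theorem card_le_of_vLine_eq_zero {K : Type*} [Field K] [Infinite K]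
    {f h : MvPolynomial (Fin 3) K} (hf : Irreducible f) (hfh : ¬ f ∣ h)
    (hdeg : h.totalDegree ≤ 3 * f.totalDegree) {B : Finset (K × K × K)}
    (hB : ∀ q ∈ B, vLine q f = 0) (hB' : ∀ q ∈ B, vLine q h = 0)
    (hinj : Set.InjOn (fun q : K × K × K => q.1) B) : B.card ≤ 16 * f.totalDegree ^ 2 := by
  obtain ⟨R, a, b, hR0, hRd, hR⟩ := MvPolynomial.exists_eliminant hf hfh
  refine (card_le_of_vLine_rename_eq_zero hR0 B (fun p hp => ?_) hinj).trans (hRd.trans ?_)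
  · rw [hR, map_add, map_mul, map_mul, hB p hp, hB' p hp, zero_mul, zero_mul, add_zero]
  · calc _ ≤ (f.totalDegree + 3 * f.totalDegree) ^ 2 := by gcongr
      _ = _ := by ring

theorem MvPolynomial.pderiv_eq_zero_of_dvd {σ K : Type*} [Field K] {f : MvPolynomial σ K} {i : σ}
    (h : f ∣ pderiv i f) : pderiv i f = 0 := by
  by_contra h0
  have h1 := totalDegree_pderiv_le i f
  obtain ⟨c, hc⟩ := h
  have hf0 : f ≠ 0 := by
    rintro rfl
    simp at h0
  have hc0 : c ≠ 0 := by
    rintro rfl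
    rw [mul_zero] at hc
    exact h0 hc
  have h2 : f.totalDegree + c.totalDegree = (pderiv i f).totalDegree := by
    conv_rhs => rw [hc]
    rw [totalDegree_mul_of_isDomain hf0 hc0]
  have h3 : f.totalDegree = 0 := by omega
  rw [totalDegree_eq_zero_iff_eq_C.mp h3, pderiv_C] at h0
  exact h0 rfl

theorem card_le_of_hLine_pderiv_eq_zero {K : Type*} [Field K] [Infinite K]
    {f : MvPolynomial (Fin 3) K} (hf : Irreducible f)
    (hchar : ∀ i : ℕ, 0 < i → i ≤ f.totalDegree → (i : K) ≠ 0) {A : Finset (K × K × K)}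
    (hA : ∀ p ∈ A, hLine p f = 0) (hA' : ∀ p ∈ A, hLine p (MvPolynomial.pderiv 0 f) = 0)
    (hinj : Set.InjOn (fun p : K × K × K => p.2.1) A) : A.card ≤ 16 * f.totalDegree ^ 2 := by
  by_cases hd : f ∣ MvPolynomial.pderiv 0 f
  · obtain ⟨R, hRd, hR⟩ := MvPolynomial.exists_rename_succ_of_pderiv_eq_zero
      (MvPolynomial.pderiv_eq_zero_of_dvd hd) hchar
    have hR0 : R ≠ 0 := by
      rintro rfl
      exact hf.ne_zero (by rw [← hR, map_zero])
    refine (card_le_of_hLine_rename_eq_zero hR0 A (fun p hp => hR ▸ hA p hp) hinj).trans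
      (hRd.trans ?_)
    nlinarith
  · refine card_le_of_hLine_eq_zero hf hd ?_ hA hA' hinj
    have := MvPolynomial.totalDegree_pderiv_le 0 f
    omega

theorem card_le_of_vLine_pderiv_eq_zero {K : Type*} [Field K] [Infinite K]
    {f : MvPolynomial (Fin 3) K} (hf : Irreducible f)
    (hchar : ∀ i : ℕ, 0 < i → i ≤ f.totalDegree → (i : K) ≠ 0) {B : Finset (K × K × K)}
    (hB : ∀ q ∈ B, vLine q f = 0) (hB' : ∀ q ∈ B, vLine q (MvPolynomial.pderiv 0 f) = 0)
    (hinj : Set.InjOn (fun q : K × K × K => q.1) B) : B.card ≤ 16 * f.totalDegree ^ 2 := by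
  by_cases hd : f ∣ MvPolynomial.pderiv 0 f
  · obtain ⟨R, hRd, hR⟩ := MvPolynomial.exists_rename_succ_of_pderiv_eq_zero
      (MvPolynomial.pderiv_eq_zero_of_dvd hd) hchar
    have hR0 : R ≠ 0 := by
      rintro rfl
      exact hf.ne_zero (by rw [← hR, map_zero])
    refine (card_le_of_vLine_rename_eq_zero hR0 B (fun p hp => hR ▸ hB p hp) hinj).trans
      (hRd.trans ?_)
    nlinarith
  · refine card_le_of_vLine_eq_zero hf hd ?_ hB hB' hinj
    have := MvPolynomial.totalDegree_pderiv_le 0 f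
    omega

theorem MvPolynomial.sub_rename_dvd {K : Type*} [Field K] {n : ℕ} {f : MvPolynomial (Fin (n + 1)) K}
    {q : MvPolynomial (Fin n) K} (h : aeval (Fin.cons q X : Fin (n + 1) → _) f = 0) :
    X 0 - rename Fin.succ q ∣ f := by
  set I := Ideal.span {X 0 - rename Fin.succ q} with hI
  have hhom : Ideal.Quotient.mkₐ K I = (Ideal.Quotient.mkₐ K I).comp
      ((rename Fin.succ).comp (aeval (Fin.cons q X : Fin (n + 1) → MvPolynomial (Fin n) K))) := by
    apply algHom_ext
    intro i
    refine Fin.cases ?_ (fun j => ?_) i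
    · simp only [AlgHom.comp_apply, aeval_X, Fin.cons_zero, Ideal.Quotient.mkₐ_eq_mk]
      exact Ideal.Quotient.eq.mpr (Ideal.mem_span_singleton_self _)
    · simp
  have := DFunLike.congr_fun hhom f
  rw [AlgHom.comp_apply, AlgHom.comp_apply, h, map_zero, map_zero, Ideal.Quotient.mkₐ_eq_mk,
    Ideal.Quotient.eq_zero_iff_mem, Ideal.mem_span_singleton] at this
  exact this

theorem hLine_eq_zero_quadric {K : Type*} [Field K] {f : MvPolynomial (Fin 3) K}
    (hf : Irreducible f) {κ l μ ν : K}
    (h : MvPolynomial.aeval ![MvPolynomial.C κ * MvPolynomial.X 0 * MvPolynomial.X 1 +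
      MvPolynomial.C l * MvPolynomial.X 0 + MvPolynomial.C μ * MvPolynomial.X 1 +
      MvPolynomial.C ν, MvPolynomial.X 0, MvPolynomial.X 1] f = (0 : MvPolynomial (Fin 2) K))
    {p : K × K × K} (hp : hLine p f = 0) :
    p.1 = κ * p.2.1 + l ∧ p.2.2 = -μ * p.2.1 + -ν := by
  set q : MvPolynomial (Fin 2) K := MvPolynomial.C κ * MvPolynomial.X 0 * MvPolynomial.X 1 +
      MvPolynomial.C l * MvPolynomial.X 0 + MvPolynomial.C μ * MvPolynomial.X 1 +
      MvPolynomial.C ν with hq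
  have hcons : (![q, MvPolynomial.X 0, MvPolynomial.X 1] : Fin 3 → MvPolynomial (Fin 2) K) =
      Fin.cons q MvPolynomial.X := by
    funext i
    fin_cases i <;> rfl
  rw [hcons] at h
  obtain ⟨c, hc⟩ := MvPolynomial.sub_rename_dvd h
  have hnu : ¬ IsUnit (MvPolynomial.X 0 - MvPolynomial.rename Fin.succ q) := by
    intro hu
    have hu' := hu.map (MvPolynomial.aeval (R := K) (Fin.cons q MvPolynomial.X :
      Fin 3 → MvPolynomial (Fin 2) K))
    rw [map_sub, MvPolynomial.aeval_X, MvPolynomial.aeval_rename, Fin.cons_zero] at hu'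
    have : (Fin.cons q MvPolynomial.X : Fin 3 → MvPolynomial (Fin 2) K) ∘ Fin.succ =
        MvPolynomial.X := by
      funext i; simp
    rw [this, MvPolynomial.aeval_X_left_apply, sub_self] at hu'
    exact not_isUnit_zero hu'
  have hcu : IsUnit c := (hf.isUnit_or_isUnit hc).resolve_left hnu
  rw [hc, map_mul] at hp
  have h0 : hLine p (MvPolynomial.X 0 - MvPolynomial.rename Fin.succ q) = 0 :=
    (mul_eq_zero.mp hp).resolve_right (hcu.map (hLine p)).ne_zero
  have hx : ∀ x : K, p.1 * x - p.2.2 - (κ * x * p.2.1 + l * x + μ * p.2.1 + ν) = 0 := by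
    intro x
    have := eval_hLine p (MvPolynomial.X 0 - MvPolynomial.rename Fin.succ q) x
    rw [h0, Polynomial.eval_zero, map_sub, MvPolynomial.eval_rename] at this
    simpa [hq] using this.symm
  have e0 := hx 0
  have e1 := hx 1
  constructor
  · linear_combination e1 - e0
  · linear_combination -e0

theorem exists_quadric_of_eval {K : Type*} [Field K] {f : MvPolynomial (Fin 3) K}
    (hf : Irreducible f) (hf1 : f ∣ flexPoly 1 f) (hf2 : f ∣ flexPoly 2 f)
    (hchar : ∀ i : ℕ, 0 < i → i ≤ f.totalDegree → (i : K) ≠ 0) {P : Fin 3 → K}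
    (hP : MvPolynomial.eval P f = 0) (hP0 : MvPolynomial.eval P (MvPolynomial.pderiv 0 f) ≠ 0)
    {A : Finset (K × K × K)} (hA : ∀ p ∈ A, hLine p f = 0) {k : ℕ}
    (hk : ∀ κ l μ ν : K,
      (A.filter fun p => p.1 = κ * p.2.1 + l ∧ p.2.2 = μ * p.2.1 + ν).card ≤ k) :
    A.card ≤ k := by
  obtain ⟨κ, l, μ, ν, h⟩ := exists_quadric_of_dvd_flexPoly hf1 hf2 hchar P hP hP0
  have := hk κ l (-μ) (-ν)
  rwa [Finset.filter_true_of_mem fun p hp => hLine_eq_zero_quadric hf h (hA p hp)] at this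

theorem meetCount_le_of_irreducible {K : Type*} [Field K] [Infinite K]
    {f : MvPolynomial (Fin 3) K} (hf : Irreducible f)
    (hchar : ∀ i : ℕ, 0 < i → i ≤ f.totalDegree → (i : K) ≠ 0)
    {A B : Finset (K × K × K)} (hA : ∀ p ∈ A, hLine p f = 0) (hB : ∀ q ∈ B, vLine q f = 0)
    (hAinj : Set.InjOn (fun p : K × K × K => p.2.1) A)
    (hBinj : Set.InjOn (fun q : K × K × K => q.1) B) {k : ℕ}
    (hk : ∀ κ l μ ν : K,
      (A.filter fun p => p.1 = κ * p.2.1 + l ∧ p.2.2 = μ * p.2.1 + ν).card ≤ k) :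
    A.card ≤ k ∨ ∃ A' ⊆ A, ∃ B' ⊆ B, A'.card ≤ 16 * f.totalDegree ^ 2 ∧
      B'.card ≤ 16 * f.totalDegree ^ 2 ∧
      meetCount A B ≤ 3 * f.totalDegree * (A.card + B.card) + meetCount A' B' := by
  rw [or_iff_not_imp_left]
  intro hAk
  set A' := A.filter fun p => hLine p (flexPoly 2 f) = 0 with hA'
  set B' := B.filter fun q => vLine q (flexPoly 1 f) = 0 with hB'
  have hd1 := totalDegree_flexPoly_le 1 f
  have hd2 := totalDegree_flexPoly_le 2 f
  have hA1 : ∀ p ∈ A', hLine p f = 0 := fun p hp => hA p (Finset.mem_filter.mp hp).1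
  have hB1 : ∀ q ∈ B', vLine q f = 0 := fun q hq => hB q (Finset.mem_filter.mp hq).1
  have hA'inj := hAinj.mono (Finset.coe_subset.mpr (Finset.filter_subset _ _) :
    (A' : Set (K × K × K)) ⊆ A)
  have hB'inj := hBinj.mono (Finset.coe_subset.mpr (Finset.filter_subset _ _) :
    (B' : Set (K × K × K)) ⊆ B)
  have hcard : A'.card ≤ 16 * f.totalDegree ^ 2 ∧ B'.card ≤ 16 * f.totalDegree ^ 2 := by
    by_cases hf1 : f ∣ flexPoly 1 f
    · by_cases hf2 : f ∣ flexPoly 2 f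
      · constructor
        · refine card_le_of_hLine_pderiv_eq_zero hf hchar hA1 (fun p hp => ?_) hA'inj
          by_contra h0
          obtain ⟨x, hx⟩ : ∃ x, (hLine p (MvPolynomial.pderiv 0 f)).eval x ≠ 0 := by
            by_contra! h
            exact h0 (Polynomial.funext fun x => by rw [h, Polynomial.eval_zero])
          rw [eval_hLine] at hx
          refine hAk (exists_quadric_of_eval hf hf1 hf2 hchar ?_ hx hA hk)
          rw [← eval_hLine, hA1 p hp, Polynomial.eval_zero]
        · refine card_le_of_vLine_pderiv_eq_zero hf hchar hB1 (fun p hp => ?_) hB'inj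
          by_contra h0
          obtain ⟨x, hx⟩ : ∃ x, (vLine p (MvPolynomial.pderiv 0 f)).eval x ≠ 0 := by
            by_contra! h
            exact h0 (Polynomial.funext fun x => by rw [h, Polynomial.eval_zero])
          rw [eval_vLine] at hx
          refine hAk (exists_quadric_of_eval hf hf1 hf2 hchar ?_ hx hA hk)
          rw [← eval_vLine, hB1 p hp, Polynomial.eval_zero]
      · exact ⟨card_le_of_hLine_eq_zero hf hf2 hd2 hA1
            (fun p hp => (Finset.mem_filter.mp hp).2) hA'inj,
          card_le_of_vLine_eq_zero hf hf2 hd2 hB1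
            (fun q hq => vLine_flexPoly_eq_zero (hB1 q hq)) hB'inj⟩
    · exact ⟨card_le_of_hLine_eq_zero hf hf1 hd1 hA1
          (fun p hp => hLine_flexPoly_eq_zero (hA1 p hp)) hA'inj,
        card_le_of_vLine_eq_zero hf hf1 hd1 hB1
          (fun q hq => (Finset.mem_filter.mp hq).2) hB'inj⟩
  refine ⟨A', Finset.filter_subset _ _, B', Finset.filter_subset _ _, hcard.1, hcard.2, ?_⟩
  rw [meetCount_filter_left A B fun p => hLine p (flexPoly 2 f) = 0,
    ← hA', meetCount_filter_right A' B fun q => vLine q (flexPoly 1 f) = 0]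
  have h1 : meetCount (A.filter fun p => ¬ hLine p (flexPoly 2 f) = 0) B ≤
      A.card * (3 * f.totalDegree) :=
    (meetCount_le_of_hLine_ne_zero (fun p hp => (Finset.mem_filter.mp hp).2)
      (fun q hq => vLine_flexPoly_eq_zero (hB q hq)) hBinj).trans
      (Nat.mul_le_mul (Finset.card_filter_le _ _) hd2)
  have h2 : meetCount A' (B.filter fun q => ¬ vLine q (flexPoly 1 f) = 0) ≤
      B.card * (3 * f.totalDegree) :=
    (meetCount_le_of_vLine_ne_zero (fun p hp => hLine_flexPoly_eq_zero (hA1 p hp))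
      (fun q hq => (Finset.mem_filter.mp hq).2) hA'inj).trans
      (Nat.mul_le_mul (Finset.card_filter_le _ _) hd1)
  linarith

theorem surface_bound_add {a1 a2 b1 b2 d e k G x11 x12 x21 x22 : ℝ} (ha1 : 0 ≤ a1) (ha2 : 0 ≤ a2)
    (hb1 : 0 ≤ b1) (hb2 : 0 ≤ b2) (hd : 0 ≤ d) (he : 0 ≤ e) (hG : 0 ≤ G)
    (h11 : x11 ≤ 3 * d * (a1 + b1) + k * b1 + 16 * d ^ 2 * G) (h12 : x12 ≤ b2 * d)
    (h21 : x21 ≤ a2 * d) (h22 : x22 ≤ 4 * (a2 + b2) * e + k * b2 + 16 * e ^ 2 * G) :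
    x11 + x12 + x21 + x22 ≤
      4 * (a1 + a2 + (b1 + b2)) * (d + e) + k * (b1 + b2) + 16 * (d + e) ^ 2 * G := by
  have p1 : 0 ≤ d * (a1 + b1) := by positivity
  have p2 : 0 ≤ d * (a2 + b2) := by positivity
  have p3 : 0 ≤ e * (a1 + b1) := by positivity
  have p4 : 0 ≤ d * e * G := by positivity
  linarith

/-- The incidences of a family of points whose dual lines lie on the surface `f = 0` are controlled
by those of small subfamilies. -/
theorem meetCount_le_of_surface {K : Type*} [Field K] [Infinite K] {G : ℝ} (hG : 0 ≤ G) {k : ℕ}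
    (f : MvPolynomial (Fin 3) K) : f ≠ 0 →
    (∀ i : ℕ, 0 < i → i ≤ f.totalDegree → (i : K) ≠ 0) →
    ∀ A B : Finset (K × K × K), (∀ p ∈ A, hLine p f = 0) →
    Set.InjOn (fun p : K × K × K => p.2.1) A → Set.InjOn (fun q : K × K × K => q.1) B →
    (∀ κ l μ ν : K,
      (A.filter fun p => p.1 = κ * p.2.1 + l ∧ p.2.2 = μ * p.2.1 + ν).card ≤ k) →
    (∀ e ≤ f.totalDegree, ∀ A' ⊆ A, ∀ B' ⊆ B, A'.card ≤ 16 * e ^ 2 → B'.card ≤ 16 * e ^ 2 →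
      (meetCount A' B' : ℝ) ≤ 16 * e ^ 2 * G) →
    (meetCount A B : ℝ) ≤ 4 * (A.card + B.card) * f.totalDegree + k * B.card +
      16 * f.totalDegree ^ 2 * G := by
  induction f using WfDvdMonoid.induction_on_irreducible with
  | zero => exact fun h => absurd rfl h
  | unit u hu =>
    intro _ _ A B hA _ _ _ _
    have hA0 : A = ∅ := by
      rw [Finset.eq_empty_iff_forall_notMem]
      intro p hp
      exact (hu.map (hLine p)).ne_zero (hA p hp)
    subst hA0
    have : meetCount (∅ : Finset (K × K × K)) B = 0 := by simp [meetCount]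
    rw [this]
    simp only [Nat.cast_zero]
    positivity
  | mul f g hf0 hg ih =>
    intro hne hchar A B hA hAinj hBinj hk hsmall
    have hdeg : (g * f).totalDegree = g.totalDegree + f.totalDegree :=
      MvPolynomial.totalDegree_mul_of_isDomain hg.ne_zero hf0
    rw [hdeg] at hchar hsmall ⊢
    set A1 := A.filter fun p => hLine p g = 0 with hA1
    set A2 := A.filter fun p => ¬ hLine p g = 0 with hA2
    set B1 := B.filter fun q => vLine q g = 0 with hB1
    set B2 := B.filter fun q => ¬ vLine q g = 0 with hB2
    have cA : A1.card + A2.card = A.card := Finset.card_filter_add_card_filter_not _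
    have cB : B1.card + B2.card = B.card := Finset.card_filter_add_card_filter_not _
    have sA1 : A1 ⊆ A := Finset.filter_subset _ _
    have sA2 : A2 ⊆ A := Finset.filter_subset _ _
    have sB1 : B1 ⊆ B := Finset.filter_subset _ _
    have sB2 : B2 ⊆ B := Finset.filter_subset _ _
    have hkm : ∀ A' ⊆ A, ∀ κ l μ ν : K,
        (A'.filter fun p => p.1 = κ * p.2.1 + l ∧ p.2.2 = μ * p.2.1 + ν).card ≤ k :=
      fun A' hA' κ l μ ν => (Finset.card_le_card (Finset.filter_subset_filter _ hA')).trans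
        (hk κ l μ ν)
    have e1 : meetCount A B = meetCount A1 B1 + meetCount A1 B2 + meetCount A2 B1 +
        meetCount A2 B2 := by
      rw [meetCount_filter_left A B fun p => hLine p g = 0,
        ← hA1, ← hA2, meetCount_filter_right A1 B fun q => vLine q g = 0,
        meetCount_filter_right A2 B fun q => vLine q g = 0]
      ring
    have h12 : meetCount A1 B2 ≤ B2.card * g.totalDegree :=
      meetCount_le_of_vLine_ne_zero (fun p hp => (Finset.mem_filter.mp hp).2)
        (fun q hq => (Finset.mem_filter.mp hq).2) (hAinj.mono (Finset.coe_subset.mpr sA1))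
    have h21 : meetCount A2 B1 ≤ A2.card * g.totalDegree :=
      meetCount_le_of_hLine_ne_zero (fun p hp => (Finset.mem_filter.mp hp).2)
        (fun q hq => (Finset.mem_filter.mp hq).2) (hBinj.mono (Finset.coe_subset.mpr sB1))
    have h22 := ih hf0 (fun i hi hi' => hchar i hi (by omega)) A2 B2 (fun p hp => by
        have h := hA p (sA2 hp)
        rw [map_mul] at h
        exact (mul_eq_zero.mp h).resolve_left (Finset.mem_filter.mp hp).2)
      (hAinj.mono (Finset.coe_subset.mpr sA2)) (hBinj.mono (Finset.coe_subset.mpr sB2))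
      (hkm A2 sA2) (fun e he A' hA' B' hB' => hsmall e (by omega) A' (hA'.trans sA2) B'
        (hB'.trans sB2))
    have h11 : (meetCount A1 B1 : ℝ) ≤ 3 * g.totalDegree * (A1.card + B1.card) + k * B1.card +
        16 * g.totalDegree ^ 2 * G := by
      rcases meetCount_le_of_irreducible hg (fun i hi hi' => hchar i hi (by omega))
        (fun p (hp : p ∈ A1) => (Finset.mem_filter.mp hp).2)
        (fun q (hq : q ∈ B1) => (Finset.mem_filter.mp hq).2)
        (hAinj.mono (Finset.coe_subset.mpr sA1)) (hBinj.mono (Finset.coe_subset.mpr sB1))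
        (hkm A1 sA1) with h | ⟨A', hA', B', hB', hcA, hcB, h⟩
      · have h1 : meetCount A1 B1 ≤ k * B1.card :=
          (meetCount_le_mul _ _).trans (Nat.mul_le_mul_right _ h)
        have h2 : (meetCount A1 B1 : ℝ) ≤ k * B1.card := by exact_mod_cast h1
        have h3 : (0 : ℝ) ≤ 3 * g.totalDegree * (A1.card + B1.card) := by positivity
        have h4 : (0 : ℝ) ≤ 16 * g.totalDegree ^ 2 * G := by positivity
        linarith
      · have h1 := hsmall g.totalDegree (by omega) A' (hA'.trans sA1) B' (hB'.trans sB1) hcA hcB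
        have h2 : (meetCount A1 B1 : ℝ) ≤ 3 * g.totalDegree * (A1.card + B1.card) +
            meetCount A' B' := by exact_mod_cast h
        have h3 : (0 : ℝ) ≤ k * B1.card := by positivity
        linarith
    have h12' : (meetCount A1 B2 : ℝ) ≤ B2.card * g.totalDegree := by exact_mod_cast h12
    have h21' : (meetCount A2 B1 : ℝ) ≤ A2.card * g.totalDegree := by exact_mod_cast h21
    have cA' : (A.card : ℝ) = A1.card + A2.card := by exact_mod_cast cA.symm
    have cB' : (B.card : ℝ) = B1.card + B2.card := by exact_mod_cast cB.symm
    have e1' : (meetCount A B : ℝ) = meetCount A1 B1 + meetCount A1 B2 + meetCount A2 B1 +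
        meetCount A2 B2 := by exact_mod_cast e1
    rw [e1', cA', cB', Nat.cast_add]
    exact surface_bound_add (Nat.cast_nonneg _) (Nat.cast_nonneg _) (Nat.cast_nonneg _)
      (Nat.cast_nonneg _) (Nat.cast_nonneg _) (Nat.cast_nonneg _) hG h11 h12' h21' h22

theorem exists_surface {K : Type*} [Field K] (A : Finset (K × K × K)) :
    ∃ f : MvPolynomial (Fin 3) K, f ≠ 0 ∧ f.totalDegree ≤ 3 * Nat.sqrt (2 * A.card) ∧
      ∀ p ∈ A, hLine p f = 0 := by
  set D := Nat.sqrt (2 * A.card) with hD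
  set m : (Fin 3 → Fin (D + 1)) → (Fin 3 →₀ ℕ) :=
    fun e => Finsupp.equivFunOnFinite.symm fun i => (e i : ℕ) with hm
  have hminj : Function.Injective m := by
    intro e e' h
    funext i
    have := DFunLike.congr_fun h i
    exact Fin.ext (by simpa [hm] using this)
  set Ψ : ((Fin 3 → Fin (D + 1)) → K) →ₗ[K] MvPolynomial (Fin 3) K :=
    Fintype.linearCombination K fun e => MvPolynomial.monomial (m e) (1 : K) with hΨ
  have hΨc : ∀ c e, (Ψ c).coeff (m e) = c e := by
    intro c e
    rw [hΨ, Fintype.linearCombination_apply, MvPolynomial.coeff_sum]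
    simp only [MvPolynomial.coeff_smul, MvPolynomial.coeff_monomial, hminj.eq_iff, smul_eq_mul,
      mul_ite, mul_one, mul_zero]
    simp
  have hdeg : ∀ p : K × K × K, ∀ c, (hLine p (Ψ c)).natDegree ≤ 2 * D := by
    intro p c
    rw [hΨ, Fintype.linearCombination_apply, map_sum]
    refine Polynomial.natDegree_sum_le_of_forall_le _ _ fun e _ => ?_
    rw [map_smul]
    refine (Polynomial.natDegree_smul_le _ _).trans ?_
    rw [hLine, MvPolynomial.aeval_monomial, map_one, one_mul,
      Finsupp.prod_fintype _ _ (by simp), Fin.prod_univ_three]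
    simp only [hm, Finsupp.equivFunOnFinite_symm_apply_apply, Matrix.cons_val_zero,
      Matrix.cons_val_one, Matrix.cons_val]
    have h0 : (Polynomial.C p.1 * Polynomial.X - Polynomial.C p.2.2).natDegree ≤ 1 := by
      compute_degree
    have h1 := Polynomial.natDegree_pow_le_of_le (e 0 : ℕ) h0
    have h2 : ((Polynomial.X : Polynomial K) ^ (e 1 : ℕ)).natDegree ≤ e 1 :=
      Polynomial.natDegree_X_pow_le _
    have h3 : ((Polynomial.C p.2.1) ^ (e 2 : ℕ)).natDegree ≤ 0 := by
      rw [← Polynomial.C_pow, Polynomial.natDegree_C]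
    have h4 := Polynomial.natDegree_mul_le_of_le (Polynomial.natDegree_mul_le_of_le h1 h2) h3
    have := (e 0).is_lt
    have := (e 1).is_lt
    omega
  set T : ((Fin 3 → Fin (D + 1)) → K) →ₗ[K] (A × Fin (2 * D + 1) → K) :=
    LinearMap.pi fun z => (Polynomial.lcoeff K (z.2 : ℕ)) ∘ₗ
      (hLine z.1.1).toLinearMap ∘ₗ Ψ with hT
  have hker : LinearMap.ker T ≠ ⊥ := by
    apply LinearMap.ker_ne_bot_of_finrank_lt
    rw [Module.finrank_fintype_fun_eq_card, Module.finrank_fintype_fun_eq_card]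
    simp only [Fintype.card_prod, Fintype.card_coe, Fintype.card_fin, Fintype.card_fun]
    have h := Nat.lt_succ_sqrt (2 * A.card)
    rw [← hD, Nat.succ_eq_add_one] at h
    nlinarith
  obtain ⟨c, hc, hc0⟩ := Submodule.exists_mem_ne_zero_of_ne_bot hker
  rw [LinearMap.mem_ker] at hc
  refine ⟨Ψ c, ?_, ?_, ?_⟩
  · intro h
    apply hc0
    funext e
    rw [← hΨc c e, h, MvPolynomial.coeff_zero, Pi.zero_apply]
  · rw [hΨ, Fintype.linearCombination_apply]
    refine MvPolynomial.totalDegree_finsetSum_le fun e _ => ?_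
    refine (MvPolynomial.totalDegree_smul_le _ _).trans ?_
    refine (MvPolynomial.totalDegree_monomial_le _ _).trans ?_
    rw [Finsupp.sum_fintype _ _ (by simp), Fin.sum_univ_three]
    simp only [hm, Finsupp.equivFunOnFinite_symm_apply_apply, id]
    have := (e 0).is_lt
    have := (e 1).is_lt
    have := (e 2).is_lt
    omega
  · intro p hp
    ext i
    rw [Polynomial.coeff_zero]
    by_cases hi : i < 2 * D + 1
    · have := congrFun hc (⟨p, hp⟩, ⟨i, hi⟩)
      simpa [hT] using this
    · exact Polynomial.coeff_eq_zero_of_natDegree_lt (by have := hdeg p c; omega)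

theorem meetCount_le_of_chunks {K : Type*} [Field K] {B : Finset (K × K × K)} {n : ℕ} {x : ℝ}
    (j : ℕ) : ∀ A : Finset (K × K × K), A.card ≤ j * n →
      (∀ A' ⊆ A, A'.card ≤ n → (meetCount A' B : ℝ) ≤ x) → (meetCount A B : ℝ) ≤ j * x := by
  induction j with
  | zero =>
    intro A hA _
    have : A = ∅ := by simpa using hA
    simp [this, meetCount]
  | succ j ih =>
    intro A hA h
    obtain ⟨A', hA', hc⟩ := Finset.exists_subset_card_eq (min_le_right n A.card)
    have h1 := h A' hA' (hc ▸ min_le_left _ _)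
    have h2 := ih (A \ A') (by
      rw [Finset.card_sdiff_of_subset hA', hc]
      have : (j + 1) * n = j * n + n := by ring
      omega) (fun A'' hA'' => h A'' (hA''.trans Finset.sdiff_subset))
    have h3 := meetCount_filter_left A B (fun p => p ∈ A')
    have e1 : (A.filter fun p => p ∈ A') = A' := by
      rw [Finset.filter_mem_eq_inter, Finset.inter_eq_right.mpr hA']
    have e2 : (A.filter fun p => ¬ p ∈ A') = A \ A' := by
      ext; simp
    rw [e1, e2] at h3
    rw [h3]
    push_cast
    linarith

/-- The constant in `meetCount_le`. -/
def meetConst : ℝ := 1152 * 1152 ^ 8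

theorem meetCount_le {K : Type*} [Field K] [Infinite K] {N : ℝ} {k : ℕ}
    (hchar : ∀ i : ℕ, 0 < i → (i : ℝ) ^ 2 ≤ N → (i : K) ≠ 0) (t : ℕ) :
    ∀ w : ℝ, 0 ≤ w → w ≤ 1152 ^ t → w ^ 8 ≤ N → ∀ A B : Finset (K × K × K),
      (A.card : ℝ) ≤ w ^ 8 → (B.card : ℝ) ≤ w ^ 8 →
      Set.InjOn (fun p : K × K × K => p.2.1) A → Set.InjOn (fun q : K × K × K => q.1) B →
      (∀ κ l μ ν : K,
        (A.filter fun p => p.1 = κ * p.2.1 + l ∧ p.2.2 = μ * p.2.1 + ν).card ≤ k) →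
      (meetCount A B : ℝ) ≤ meetConst * w ^ 8 * (w ^ 4 + k * w) := by
  have hbase : ∀ w : ℝ, 0 ≤ w → w ^ 4 ≤ 24 * 1152 ^ 4 → ∀ A B : Finset (K × K × K),
      (A.card : ℝ) ≤ w ^ 8 → (B.card : ℝ) ≤ w ^ 8 →
      (meetCount A B : ℝ) ≤ meetConst * w ^ 8 * (w ^ 4 + k * w) := by
    intro w hw hw4 A B hA hB
    have h1 : (meetCount A B : ℝ) ≤ A.card * B.card := by exact_mod_cast meetCount_le_mul A B
    have h2 : (A.card : ℝ) * B.card ≤ w ^ 8 * w ^ 8 := by gcongr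
    have h3 : w ^ 8 * w ^ 8 ≤ w ^ 8 * (24 * 1152 ^ 4 * w ^ 4) := by
      have : w ^ 8 = w ^ 4 * w ^ 4 := by ring
      gcongr
      rw [this]
      gcongr
    have h4 : (24 * 1152 ^ 4 : ℝ) ≤ meetConst := by norm_num [meetConst]
    have h5 : w ^ 8 * (24 * 1152 ^ 4 * w ^ 4) ≤ w ^ 8 * (meetConst * (w ^ 4 + k * w)) := by
      have : 0 ≤ k * w := by positivity
      have h6 : w ^ 4 ≤ w ^ 4 + k * w := by linarith
      gcongr
    calc _ ≤ _ := h1.trans (h2.trans (h3.trans h5))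
      _ = _ := by ring
  induction t with
  | zero =>
    intro w hw hw1 _ A B hA hB _ _ _
    refine hbase w hw ?_ A B hA hB
    have : w ^ 4 ≤ 1 := pow_le_one₀ hw (by simpa using hw1)
    norm_num
    linarith
  | succ t ih =>
    intro w hw hwt hwN A B hA hB hAinj hBinj hk
    by_cases hw4 : w ^ 4 ≤ 24 * 1152 ^ 4
    · exact hbase w hw hw4 A B hA hB
    push Not at hw4
    set q : ℕ := 576 * 1152 ^ 8 with hq
    have hqR : (q : ℝ) = 576 * 1152 ^ 8 := by norm_num [hq]
    have hq0 : (0 : ℝ) < q := by rw [hqR]; positivity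
    have hw1 : 1 ≤ w := by
      by_contra! h
      have : w ^ 4 ≤ 1 := pow_le_one₀ hw h.le
      exact absurd (hw4.trans_le this) (by norm_num)
    have hwq : (q : ℝ) ≤ w ^ 8 := by
      have : ((24 : ℝ) * 1152 ^ 4) ^ 2 ≤ (w ^ 4) ^ 2 := by gcongr
      rw [hqR]
      calc (576 * 1152 ^ 8 : ℝ) = (24 * 1152 ^ 4) ^ 2 := by norm_num
        _ ≤ _ := this
        _ = _ := by ring
    set n := ⌈w ^ 8 / q⌉₊ with hn
    have hn1 : (n : ℝ) ≤ 2 * (w ^ 8 / q) := by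
      have h1 := (Nat.ceil_lt_add_one (by positivity : 0 ≤ w ^ 8 / (q : ℝ))).le
      rw [← hn] at h1
      have h2 : 1 ≤ w ^ 8 / q := by rwa [le_div_iff₀ hq0, one_mul]
      linarith
    have hAn : A.card ≤ q * n := by
      have h1 := Nat.le_ceil (w ^ 8 / (q : ℝ))
      rw [← hn, div_le_iff₀ hq0] at h1
      have : (A.card : ℝ) ≤ q * n := by linarith
      exact_mod_cast this
    set v := w / 1152 with hv
    have hv0 : 0 ≤ v := by positivity
    have hvt : v ≤ 1152 ^ t := by
      rw [hv, div_le_iff₀ (by norm_num)]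
      calc w ≤ _ := hwt
        _ = _ := pow_succ _ _
    have hwv : w = 1152 * v := by rw [hv]; ring
    have hv8 : 36 * (w ^ 8 / q) = v ^ 8 / 16 := by
      rw [hwv, hqR]; ring
    set G := meetConst * (v ^ 4 + k * v) with hG
    have hM0 : 0 ≤ meetConst := by norm_num [meetConst]
    have hG0 : 0 ≤ G := by positivity
    have hchunk : ∀ A' ⊆ A, A'.card ≤ n →
        (meetCount A' B : ℝ) ≤ 2 * w ^ 8 * v ^ 4 + k * w ^ 8 + v ^ 8 * G := by
      intro A' hA' hc
      obtain ⟨f, hf0, hfd, hf⟩ := exists_surface A'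
      set d := f.totalDegree with hd
      have hd2 : (d : ℝ) ^ 2 ≤ v ^ 8 / 16 := by
        have h1 : d ^ 2 ≤ 18 * n := by
          have h2 := Nat.sqrt_le' (2 * A'.card)
          calc d ^ 2 ≤ (3 * Nat.sqrt (2 * A'.card)) ^ 2 := by gcongr
            _ = 9 * (Nat.sqrt (2 * A'.card)) ^ 2 := by ring
            _ ≤ 9 * (2 * A'.card) := by gcongr
            _ ≤ 18 * n := by omega
        have h2 : (d : ℝ) ^ 2 ≤ 18 * n := by exact_mod_cast h1
        linarith
      have hd1 : (d : ℝ) ≤ v ^ 4 / 4 := by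
        refine le_of_sq_le_sq ?_ (by positivity)
        calc (d : ℝ) ^ 2 ≤ _ := hd2
          _ = _ := by ring
      have hvN : v ^ 8 / 16 ≤ N := by
        have : v ≤ w := by rw [hv]; exact div_le_self hw (by norm_num)
        have h8 : v ^ 8 ≤ w ^ 8 := by gcongr
        have : 0 ≤ v ^ 8 := by positivity
        linarith
      have hcr : (A'.card : ℝ) ≤ w ^ 8 :=
        le_trans (by exact_mod_cast Finset.card_le_card hA') hA
      have hmain := meetCount_le_of_surface hG0 (k := k) f hf0 (fun i hi hid => hchar i hi (by
          have : (i : ℝ) ≤ d := by exact_mod_cast hid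
          calc (i : ℝ) ^ 2 ≤ (d : ℝ) ^ 2 := by gcongr
            _ ≤ _ := hd2.trans hvN)) A' B hf (hAinj.mono (Finset.coe_subset.mpr hA')) hBinj
        (fun κ l μ ν => (Finset.card_le_card (Finset.filter_subset_filter _ hA')).trans
          (hk κ l μ ν)) (by
          intro e he A'' hA'' B'' hB'' hcA hcB
          obtain ⟨y, hy0, hy⟩ : ∃ y : ℝ, 0 ≤ y ∧ y ^ 8 = 16 * (e : ℝ) ^ 2 := by
            refine ⟨√√√(16 * (e : ℝ) ^ 2), Real.sqrt_nonneg _, ?_⟩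
            calc √√√(16 * (e : ℝ) ^ 2) ^ 8 = ((√√√(16 * (e : ℝ) ^ 2) ^ 2) ^ 2) ^ 2 := by ring
              _ = _ := by
                rw [Real.sq_sqrt (Real.sqrt_nonneg _), Real.sq_sqrt (Real.sqrt_nonneg _),
                  Real.sq_sqrt (by positivity)]
          have hyv : y ≤ v := by
            refine le_of_pow_le_pow_left₀ (n := 8) (by norm_num) hv0 ?_
            have : (e : ℝ) ≤ d := by exact_mod_cast he
            have h2 : (e : ℝ) ^ 2 ≤ (d : ℝ) ^ 2 := by gcongr
            rw [hy]
            linarith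
          have hvw : v ≤ w := by rw [hv]; exact div_le_self hw (by norm_num)
          have h := ih y hy0 (hyv.trans hvt)
            (le_trans (pow_le_pow_left₀ hy0 (hyv.trans hvw) 8) hwN) A'' B''
            (by rw [hy]; exact_mod_cast hcA) (by rw [hy]; exact_mod_cast hcB)
            (hAinj.mono (Finset.coe_subset.mpr (hA''.trans hA')))
            (hBinj.mono (Finset.coe_subset.mpr hB''))
            (fun κ l μ ν => (Finset.card_le_card
              (Finset.filter_subset_filter _ (hA''.trans hA'))).trans (hk κ l μ ν))
          calc _ ≤ _ := h
            _ = y ^ 8 * (meetConst * (y ^ 4 + k * y)) := by ring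
            _ ≤ y ^ 8 * (meetConst * (v ^ 4 + k * v)) := by gcongr
            _ = _ := by rw [hy])
      calc _ ≤ _ := hmain
        _ ≤ 4 * (w ^ 8 + w ^ 8) * (v ^ 4 / 4) + k * w ^ 8 + 16 * (v ^ 8 / 16) * G := by gcongr
        _ = _ := by ring
    have htot := meetCount_le_of_chunks q A hAn hchunk
    refine htot.trans ?_
    have hk9 : (k : ℝ) * w ^ 8 ≤ k * w ^ 8 * w := le_mul_of_one_le_right (by positivity) hw1
    have hq8 : (q : ℝ) * v ^ 8 = 576 * w ^ 8 := by
      rw [hwv, hqR]; ring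
    have hv4 : v ^ 4 ≤ w ^ 4 / 1152 := by
      rw [hwv]
      have : 0 ≤ v ^ 4 := by positivity
      rw [mul_pow]
      norm_num
      linarith
    have hqM : (q : ℝ) = meetConst / 2 := by rw [hqR, meetConst]; ring
    calc (q : ℝ) * (2 * w ^ 8 * v ^ 4 + k * w ^ 8 + v ^ 8 * G)
        = q * (2 * w ^ 8 * v ^ 4) + q * (k * w ^ 8) + (q * v ^ 8) * G := by ring
      _ = meetConst * w ^ 8 * (577 * v ^ 4) + meetConst / 2 * (k * w ^ 8) +
          meetConst / 2 * (k * w ^ 8 * w) := by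
        rw [hq8, hqM, hG, hwv]; ring
      _ ≤ meetConst * w ^ 8 * w ^ 4 + meetConst / 2 * (k * w ^ 8 * w) +
          meetConst / 2 * (k * w ^ 8 * w) := by
        have : 577 * v ^ 4 ≤ w ^ 4 := by
          have : 0 ≤ w ^ 4 := by positivity
          linarith
        gcongr
      _ = _ := by ring

theorem exists_forall_add_mul_ne_zero {K : Type*} [Field K] [Infinite K] (S : Finset (K × K))
    (hS : ∀ z ∈ S, z.2 = 0 → z.1 ≠ 0) : ∃ η : K, ∀ z ∈ S, z.1 + η * z.2 ≠ 0 := by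
  obtain ⟨η, hη⟩ := Infinite.exists_notMem_finset (S.image fun z => -z.1 / z.2)
  refine ⟨η, fun z hz h0 => ?_⟩
  by_cases h2 : z.2 = 0
  · rw [h2, mul_zero, add_zero] at h0
    exact hS z hz h2 h0
  · refine hη (Finset.mem_image.mpr ⟨z, hz, ?_⟩)
    field_simp
    linear_combination -h0

/-- The number of coincidences among the values at the points of `A` of the affine functions
`x ↦ s * x + t` with `(s, t)` in `L`. -/
noncomputable def lineEnergy {K : Type*} [Field K] (A : Finset K) (L : Finset (K × K)) : ℕ :=
  (((A ×ˢ L) ×ˢ (A ×ˢ L)).filter fun z =>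
    z.1.2.1 * z.1.1 + z.1.2.2 = z.2.2.1 * z.2.1 + z.2.2.2).card

theorem lineEnergy_le_of_infinite {K : Type*} [Field K] [Infinite K] {N : ℝ} {k : ℕ}
    (hchar : ∀ i : ℕ, 0 < i → (i : ℝ) ^ 2 ≤ N → (i : K) ≠ 0) {w : ℝ} (hw : 0 ≤ w)
    (hwN : w ^ 8 ≤ N) {A : Finset K} {L : Finset (K × K)} (hAL : (A.card : ℝ) * L.card ≤ w ^ 8)
    (hA : A.card ≤ k)
    (hL : ∀ a b c : K, (a, b) ≠ (0, 0) → (L.filter fun l => a * l.1 + b * l.2 = c).card ≤ k) :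
    (lineEnergy A L : ℝ) ≤ meetConst * w ^ 8 * (w ^ 4 + k * w) := by
  obtain ⟨η, hη⟩ := exists_forall_add_mul_ne_zero
    (A.image (fun x => ((1 : K), -x)) ∪
      ((L ×ˢ L).filter fun z => z.1 ≠ z.2).image fun z => (z.1.1 - z.2.1, z.1.2 - z.2.2)) (by
      intro z hz
      rw [Finset.mem_union, Finset.mem_image, Finset.mem_image] at hz
      rcases hz with ⟨x, _, rfl⟩ | ⟨y, hy, rfl⟩
      · simp
      · intro h1 h2
        exact (Finset.mem_filter.mp hy).2 (Prod.ext (sub_eq_zero.mp h2) (sub_eq_zero.mp h1)))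
  have hη1 : ∀ x ∈ A, 1 - η * x ≠ 0 := by
    intro x hx
    have := hη (1, -x) (Finset.mem_union_left _ (Finset.mem_image_of_mem _ hx))
    simpa [sub_eq_add_neg] using this
  have hη2 : ∀ l ∈ L, ∀ l' ∈ L, l.1 + η * l.2 = l'.1 + η * l'.2 → l = l' := by
    intro l hl l' hl' h
    by_contra hne
    refine hη (l.1 - l'.1, l.2 - l'.2) (Finset.mem_union_right _ (Finset.mem_image.mpr
      ⟨(l, l'), Finset.mem_filter.mpr ⟨Finset.mk_mem_product hl hl', hne⟩, rfl⟩)) ?_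
    linear_combination h
  obtain ⟨ε, hε⟩ := exists_forall_add_mul_ne_zero
    ((((A ×ˢ L) ×ˢ (A ×ˢ L)).filter fun z => z.1 ≠ z.2).image fun z =>
      ((z.1.2.1 + η * z.1.2.2) * (1 - η * z.2.1) - (z.2.2.1 + η * z.2.2.2) * (1 - η * z.1.1),
        z.1.1 - z.2.1)) (by
      intro z hz
      obtain ⟨⟨⟨x, l⟩, ⟨x', l'⟩⟩, hy, rfl⟩ := Finset.mem_image.mp hz
      simp only [Finset.mem_filter, Finset.mem_product] at hy
      obtain ⟨⟨⟨hx, hl⟩, hx', hl'⟩, hne⟩ := hy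
      intro h1 h2
      have hxx : x = x' := sub_eq_zero.mp h1
      subst hxx
      refine hne (Prod.ext rfl (hη2 l hl l' hl' ?_))
      simp only at h2
      rw [← sub_mul] at h2
      exact sub_eq_zero.mp ((mul_eq_zero.mp h2).resolve_right (hη1 x hx)))
  set φ : K × K × K → K := fun y => (y.2.1 + ε * y.1 + η * y.2.2) / (1 - η * y.1) with hφ
  have hφinj : Set.InjOn φ (A ×ˢ L : Finset (K × K × K)) := by
    rintro ⟨x, l⟩ hy ⟨x', l'⟩ hy' h
    by_contra hne
    have hx := (Finset.mem_product.mp hy).1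
    have hx' := (Finset.mem_product.mp hy').1
    refine hε _ (Finset.mem_image.mpr
      ⟨((x, l), (x', l')), Finset.mem_filter.mpr ⟨Finset.mk_mem_product hy hy', hne⟩, rfl⟩) ?_
    simp only [hφ] at h
    rw [div_eq_div_iff (hη1 x hx) (hη1 x' hx')] at h
    simp only
    linear_combination h
  set Φ : K × K × K → K × K × K := fun y => (y.1 / (1 - η * y.1), φ y, y.2.2 / (1 - η * y.1))
    with hΦ
  set Ψ : K × K × K → K × K × K := fun y => (φ y, y.1 / (1 - η * y.1), y.2.2 / (1 - η * y.1))
    with hΨ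
  have hΦinj : Set.InjOn Φ (A ×ˢ L : Finset (K × K × K)) := fun y hy y' hy' h =>
    hφinj hy hy' (congrArg (fun p : K × K × K => p.2.1) h)
  have hΨinj : Set.InjOn Ψ (A ×ˢ L : Finset (K × K × K)) := fun y hy y' hy' h =>
    hφinj hy hy' (congrArg (fun p : K × K × K => p.1) h)
  have hle : lineEnergy A L ≤ meetCount ((A ×ˢ L).image Φ) ((A ×ˢ L).image Ψ) := by
    refine Finset.card_le_card_of_injOn
      (fun z => (Φ (z.1.1, z.2.2), Ψ (z.2.1, z.1.2))) ?_ ?_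
    · rintro ⟨⟨x, s, t⟩, ⟨x', s', t'⟩⟩ hz
      simp only [Finset.coe_filter, Finset.mem_product, Set.mem_ofPred_eq] at hz
      obtain ⟨⟨⟨hx, hl⟩, hx', hl'⟩, heq⟩ := hz
      simp only [Finset.coe_filter, Finset.mem_product, Set.mem_ofPred_eq]
      refine ⟨⟨Finset.mem_image_of_mem _ (Finset.mk_mem_product hx hl'),
        Finset.mem_image_of_mem _ (Finset.mk_mem_product hx' hl)⟩, ?_⟩
      have h1 := hη1 x hx
      have h2 := hη1 x' hx'
      simp only [Meet, hΦ, hΨ, hφ]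
      obtain ⟨g, hg⟩ : ∃ g, g = 1 - η * x := ⟨_, rfl⟩
      obtain ⟨h, hh⟩ : ∃ h, h = 1 - η * x' := ⟨_, rfl⟩
      rw [← hg] at h1 ⊢
      rw [← hh] at h2 ⊢
      field_simp
      linear_combination heq + t * hg - t' * hh
    · rintro ⟨⟨x, l⟩, ⟨x', l'⟩⟩ hz ⟨⟨y, m⟩, ⟨y', m'⟩⟩ hz' h
      simp only [Finset.coe_filter, Finset.mem_product, Set.mem_ofPred_eq] at hz hz'
      obtain ⟨h1, h2⟩ := Prod.ext_iff.mp h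
      have e1 := hΦinj (Finset.mk_mem_product hz.1.1.1 hz.1.2.2)
        (Finset.mk_mem_product hz'.1.1.1 hz'.1.2.2) h1
      have e2 := hΨinj (Finset.mk_mem_product hz.1.2.1 hz.1.1.2)
        (Finset.mk_mem_product hz'.1.2.1 hz'.1.1.2) h2
      simp only [Prod.mk.injEq] at e1 e2 ⊢
      exact ⟨⟨e1.1, e2.2⟩, e2.1, e1.2⟩
  have hcol : ∀ κ l μ ν : K, (((A ×ˢ L).image Φ).filter fun p =>
      p.1 = κ * p.2.1 + l ∧ p.2.2 = μ * p.2.1 + ν).card ≤ k := by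
    intro κ l μ ν
    rw [Finset.filter_image]
    refine Finset.card_image_le.trans ?_
    by_cases hκ : κ = 0
    · subst hκ
      have hlη : 1 + l * η ≠ 0 ∨ ((A ×ˢ L).filter fun y =>
          (Φ y).1 = 0 * (Φ y).2.1 + l ∧ (Φ y).2.2 = μ * (Φ y).2.1 + ν) = ∅ := by
        by_contra! h
        obtain ⟨h1, ⟨x, m⟩, hy⟩ := h
        rw [Finset.mem_filter, Finset.mem_product] at hy
        have hx := hη1 x hy.1.1
        have h2 := hy.2.1
        simp only [hΦ, zero_mul, zero_add] at h2
        rw [div_eq_iff hx] at h2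
        have hl : l = 0 := by linear_combination x * h1 - h2
        rw [hl] at h1
        simp at h1
      rcases hlη with hlη | hem
      · set x0 := l / (1 + l * η) with hx0
        refine (Finset.card_le_card_of_injOn (fun y => y.2) ?_ ?_).trans
          (hL (-μ) (1 - μ * η) (μ * ε * x0 + ν * (1 - η * x0)) ?_)
        · rintro ⟨x, m⟩ hy
          simp only [Finset.coe_filter, Finset.mem_product, Set.mem_ofPred_eq] at hy ⊢
          obtain ⟨⟨hx, hm⟩, h1, h2⟩ := hy
          have hx1 := hη1 x hx
          simp only [hΦ, hφ, zero_mul, zero_add] at h1 h2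
          rw [div_eq_iff hx1] at h1
          have hxx : x = x0 := by
            rw [hx0, eq_div_iff hlη]
            linear_combination h1
          field_simp at h2
          refine ⟨hm, ?_⟩
          rw [← hxx]
          linear_combination h2
        · rintro ⟨x, m⟩ hy ⟨x', m'⟩ hy' h
          simp only [Finset.coe_filter, Finset.mem_product, Set.mem_ofPred_eq] at hy hy'
          have h1 := hy.2.1
          have h1' := hy'.2.1
          simp only [hΦ, zero_mul, zero_add] at h1 h1'
          rw [div_eq_iff (hη1 x hy.1.1)] at h1
          rw [div_eq_iff (hη1 x' hy'.1.1)] at h1'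
          refine Prod.ext (mul_right_cancel₀ hlη ?_) h
          simp only
          linear_combination h1 - h1'
        · intro h
          have e1 := congrArg Prod.fst h
          have e2 := congrArg Prod.snd h
          simp only [neg_eq_zero] at e1 e2
          rw [e1] at e2
          simp at e2
      · rw [hem]
        simp
    · refine (Finset.card_le_card_of_injOn (fun y => y.1) ?_ ?_).trans hA
      · rintro ⟨x, m⟩ hy
        simp only [Finset.coe_filter, Finset.mem_product, Set.mem_ofPred_eq] at hy
        exact hy.1.1
      · rintro ⟨x, m⟩ hy ⟨x', m'⟩ hy' h
        simp only at h
        subst h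
        refine hφinj (Finset.mem_filter.mp hy).1 (Finset.mem_filter.mp hy').1 ?_
        have h1 := (Finset.mem_filter.mp hy).2.1
        have h1' := (Finset.mem_filter.mp hy').2.1
        simp only [hΦ] at h1 h1'
        exact mul_left_cancel₀ hκ (add_right_cancel (h1.symm.trans h1'))
  have hcard : ∀ Θ : K × K × K → K × K × K, (((A ×ˢ L).image Θ).card : ℝ) ≤ w ^ 8 := by
    intro Θ
    refine le_trans ?_ hAL
    have : ((A ×ˢ L).image Θ).card ≤ A.card * L.card := by
      rw [← Finset.card_product]
      exact Finset.card_image_le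
    exact_mod_cast this
  obtain ⟨t, ht⟩ := pow_unbounded_of_one_lt w (by norm_num : (1 : ℝ) < 1152)
  have hmain := meetCount_le hchar t w hw ht.le hwN _ _ (hcard Φ) (hcard Ψ) ?_ ?_ hcol
  · exact le_trans (by exact_mod_cast hle) hmain
  · intro p hp p' hp' h
    obtain ⟨y, hy, rfl⟩ := Finset.mem_image.mp (Finset.mem_coe.mp hp)
    obtain ⟨y', hy', rfl⟩ := Finset.mem_image.mp (Finset.mem_coe.mp hp')
    rw [hφinj hy hy' h]
  · intro p hp p' hp' h
    obtain ⟨y, hy, rfl⟩ := Finset.mem_image.mp (Finset.mem_coe.mp hp)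
    obtain ⟨y', hy', rfl⟩ := Finset.mem_image.mp (Finset.mem_coe.mp hp')
    rw [hφinj hy hy' h]

theorem lineEnergy_le {F : Type*} [Field F] {N : ℝ} {k : ℕ}
    (hchar : ∀ i : ℕ, 0 < i → (i : ℝ) ^ 2 ≤ N → (i : F) ≠ 0) {w : ℝ} (hw : 0 ≤ w)
    (hwN : w ^ 8 ≤ N) {A : Finset F} {L : Finset (F × F)} (hAL : (A.card : ℝ) * L.card ≤ w ^ 8)
    (hA : A.card ≤ k) (hk : 1 ≤ k)
    (hL : ∀ a b c : F, (a, b) ≠ (0, 0) → (L.filter fun l => a * l.1 + b * l.2 = c).card ≤ k) :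
    (lineEnergy A L : ℝ) ≤ meetConst * w ^ 8 * (w ^ 4 + k * w) := by
  set i := algebraMap F (AlgebraicClosure F) with hi
  have hinj : Function.Injective i := i.injective
  set j : F × F → AlgebraicClosure F × AlgebraicClosure F := Prod.map i i with hj
  have hjinj : Function.Injective j := hinj.prodMap hinj
  have hle : lineEnergy A L ≤ lineEnergy (A.image i) (L.image j) := by
    refine Finset.card_le_card_of_injOn
      (Prod.map (Prod.map i j) (Prod.map i j)) ?_
      (((hinj.prodMap hjinj).prodMap (hinj.prodMap hjinj)).injOn)
    rintro ⟨⟨x, s, t⟩, ⟨x', s', t'⟩⟩ hz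
    simp only [Finset.coe_filter, Finset.mem_product, Set.mem_ofPred_eq] at hz
    obtain ⟨⟨⟨hx, hl⟩, hx', hl'⟩, heq⟩ := hz
    simp only [Finset.coe_filter, Finset.mem_product, Set.mem_ofPred_eq]
    refine ⟨⟨⟨Finset.mem_image_of_mem _ hx, Finset.mem_image_of_mem _ hl⟩,
      Finset.mem_image_of_mem _ hx', Finset.mem_image_of_mem _ hl'⟩, ?_⟩
    simp only [Prod.map_apply, hj, ← map_mul, ← map_add]
    rw [heq]
  refine le_trans (by exact_mod_cast hle) (lineEnergy_le_of_infinite (N := N) ?_ hw hwN ?_ ?_ ?_)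
  · intro n hn hnN h
    refine hchar n hn hnN (hinj ?_)
    rw [map_natCast, h, map_zero]
  · rwa [Finset.card_image_of_injective _ hinj, Finset.card_image_of_injective _ hjinj]
  · rwa [Finset.card_image_of_injective _ hinj]
  · intro a b c hab
    rw [Finset.filter_image]
    refine Finset.card_image_le.trans ?_
    set T := L.filter fun l => a * (j l).1 + b * (j l).2 = c with hT
    by_cases h1 : T.card ≤ 1
    · exact h1.trans hk
    push Not at h1
    obtain ⟨l, hl, l', hl', hne⟩ := Finset.one_lt_card.mp h1
    refine (Finset.card_le_card ?_).trans (hL (l'.2 - l.2) (l.1 - l'.1)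
      ((l'.2 - l.2) * l.1 + (l.1 - l'.1) * l.2) ?_)
    · intro m hm
      rw [hT, Finset.mem_filter] at hl hl' hm
      refine Finset.mem_filter.mpr ⟨hm.1, hinj ?_⟩
      have e1 := hl.2
      have e2 := hl'.2
      have e3 := hm.2
      simp only [hj, Prod.map_fst, Prod.map_snd] at e1 e2 e3
      simp only [map_add, map_mul, map_sub]
      by_cases ha : a = 0
      · have hb : b ≠ 0 := by
          rintro rfl
          exact hab (by rw [ha])
        refine mul_left_cancel₀ hb ?_
        subst ha
        linear_combination (i l.1 - i l'.1) * (e3 - e1) + (i m.1 - i l.1) * (e2 - e1)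
      · refine mul_left_cancel₀ ha ?_
        linear_combination (i l'.2 - i l.2) * (e3 - e1) + (i l.2 - i m.2) * (e2 - e1)
    · intro h
      have e1 := congrArg Prod.fst h
      have e2 := congrArg Prod.snd h
      exact hne (Prod.ext (sub_eq_zero.mp e2) (sub_eq_zero.mp e1).symm)

/-- The line through two distinct points. -/
def lineThrough {F : Type*} [Field F] (q r : F × F) : Set (F × F) :=
  {z | (r.2 - q.2) * (z.1 - q.1) = (r.1 - q.1) * (z.2 - q.2)}

theorem left_mem_lineThrough {F : Type*} [Field F] (q r : F × F) : q ∈ lineThrough q r := by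
  simp [lineThrough]

theorem right_mem_lineThrough {F : Type*} [Field F] (q r : F × F) : r ∈ lineThrough q r := by
  simp [lineThrough, mul_comm]

theorem isLine_lineThrough {F : Type*} [Field F] {q r : F × F} (h : q ≠ r) :
    IsLine (lineThrough q r) := by
  refine ⟨r.2 - q.2, -(r.1 - q.1), (r.2 - q.2) * q.1 - (r.1 - q.1) * q.2, ?_, ?_⟩
  · intro h0
    simp only [Prod.mk.injEq, neg_eq_zero, sub_eq_zero] at h0
    exact h (Prod.ext h0.2.symm h0.1.symm)
  · ext z
    simp only [lineThrough, Set.mem_ofPred_eq]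
    constructor <;> intro hz <;> linear_combination hz

theorem IsLine.eq_lineThrough {F : Type*} [Field F] {ℓ : Set (F × F)} (hℓ : IsLine ℓ)
    {q r : F × F} (hq : q ∈ ℓ) (hr : r ∈ ℓ) (h : q ≠ r) : ℓ = lineThrough q r := by
  obtain ⟨α, β, γ, h0, rfl⟩ := hℓ
  simp only [Set.mem_ofPred_eq] at hq hr
  ext z
  simp only [lineThrough, Set.mem_ofPred_eq]
  constructor
  · intro hz
    by_cases hα : α = 0
    · subst hα
      have hβ : β ≠ 0 := fun hβ => h0 (by rw [hβ])
      refine mul_left_cancel₀ hβ ?_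
      linear_combination (z.1 - q.1) * (hr - hq) - (r.1 - q.1) * (hz - hq)
    · refine mul_left_cancel₀ hα ?_
      linear_combination (r.2 - q.2) * (hz - hq) - (z.2 - q.2) * (hr - hq)
  · intro hz
    by_cases h1 : r.1 = q.1
    · have h2 : r.2 - q.2 ≠ 0 := fun h2 => h (Prod.ext h1.symm (sub_eq_zero.mp h2).symm)
      refine mul_left_cancel₀ h2 ?_
      linear_combination α * hz + (z.2 - q.2) * (hr - hq) + (r.2 - q.2) * hq
    · have h2 : r.1 - q.1 ≠ 0 := sub_ne_zero.mpr h1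
      refine mul_left_cancel₀ h2 ?_
      linear_combination -β * hz + (z.1 - q.1) * (hr - hq) + (r.1 - q.1) * hq

theorem IsLine.eq_of_mem {F : Type*} [Field F] {ℓ ℓ' : Set (F × F)} (hℓ : IsLine ℓ)
    (hℓ' : IsLine ℓ') {q r : F × F} (h : q ≠ r) (hq : q ∈ ℓ) (hr : r ∈ ℓ) (hq' : q ∈ ℓ')
    (hr' : r ∈ ℓ') : ℓ = ℓ' :=
  (hℓ.eq_lineThrough hq hr h).trans (hℓ'.eq_lineThrough hq' hr' h).symm

theorem mul_card_le_card_of_fiber {α β : Type*} {S : Finset α} {T : Finset β} {f : α → β} {n : ℕ}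
    (h : ∀ b ∈ T, n ≤ (S.filter fun a => f a = b).card) : n * T.card ≤ S.card := by
  calc n * T.card = ∑ b ∈ T, n := by rw [Finset.sum_const, smul_eq_mul, mul_comm]
    _ ≤ ∑ b ∈ T, (S.filter fun a => f a = b).card := Finset.sum_le_sum h
    _ = (T.biUnion fun b => S.filter fun a => f a = b).card := by
        refine (Finset.card_biUnion ?_).symm
        intro b _ b' _ hbb
        rw [Function.onFun, Finset.disjoint_left]
        intro a ha ha'
        exact hbb ((Finset.mem_filter.mp ha).2.symm.trans (Finset.mem_filter.mp ha').2)
    _ ≤ S.card := Finset.card_le_card (Finset.biUnion_subset.mpr fun b _ =>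
        Finset.filter_subset _ _)

/-- If the members of a family of sets with more than `κ` elements of `P` each pairwise share at
most one common point `o`, then the family has at most `P.card / κ` members. -/
theorem mul_card_le_card_of_sunflower {α : Type*} {P : Finset α} {T : Finset (Set α)} {κ : ℕ}
    (hT : ∀ ℓ ∈ T, κ < (P.filter fun q => q ∈ ℓ).card) {o : α}
    (ho : ∀ ℓ ∈ T, ∀ ℓ' ∈ T, ℓ ≠ ℓ' → ∀ q ∈ ℓ, q ∈ ℓ' → q = o) : κ * T.card ≤ P.card := by
  calc κ * T.card = ∑ ℓ ∈ T, κ := by rw [Finset.sum_const, smul_eq_mul, mul_comm]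
    _ ≤ ∑ ℓ ∈ T, ((P.filter fun q => q ∈ ℓ).erase o).card := by
        refine Finset.sum_le_sum fun ℓ hℓ => ?_
        have := hT ℓ hℓ
        have := Finset.pred_card_le_card_erase (s := P.filter fun q => q ∈ ℓ) (a := o)
        omega
    _ = (T.biUnion fun ℓ => (P.filter fun q => q ∈ ℓ).erase o).card := by
        refine (Finset.card_biUnion ?_).symm
        intro ℓ hℓ ℓ' hℓ' hne
        rw [Function.onFun, Finset.disjoint_left]
        intro q hq hq'
        simp only [Finset.mem_erase, Finset.mem_filter] at hq hq'
        exact hq.1 (ho ℓ hℓ ℓ' hℓ' hne q hq.2.2 hq'.2.2)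
    _ ≤ P.card := Finset.card_le_card (Finset.biUnion_subset.mpr fun ℓ _ =>
        (Finset.erase_subset _ _).trans (Finset.filter_subset _ _))

theorem card_mul_sq_le_card_sq {F : Type*} [Field F] {P : Finset (F × F)}
    {L : Finset (Set (F × F))} {κ : ℕ} (hL : ∀ ℓ ∈ L, IsLine ℓ)
    (hLκ : ∀ ℓ ∈ L, κ < (P.filter fun q => q ∈ ℓ).card) : κ ^ 2 * L.card ≤ P.card ^ 2 := by
  have h : κ ^ 2 * L.card ≤ P.offDiag.card := by
    refine mul_card_le_card_of_fiber (f := fun z => lineThrough z.1 z.2) fun ℓ hℓ => ?_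
    have h1 : (P.filter fun q => q ∈ ℓ).offDiag ⊆
        P.offDiag.filter fun z => lineThrough z.1 z.2 = ℓ := by
      rintro ⟨q, r⟩ hz
      simp only [Finset.mem_offDiag, Finset.mem_filter] at hz ⊢
      exact ⟨⟨hz.1.1, hz.2.1.1, hz.2.2⟩,
        ((hL ℓ hℓ).eq_lineThrough hz.1.2 hz.2.1.2 hz.2.2).symm⟩
    refine le_trans ?_ (Finset.card_le_card h1)
    rw [Finset.offDiag_card]
    have := hLκ ℓ hℓ
    obtain ⟨d, hd⟩ := Nat.exists_eq_add_of_lt this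
    rw [hd]
    refine Nat.le_sub_of_add_le ?_
    nlinarith [Nat.zero_le (κ * d), Nat.zero_le (d * d), Nat.zero_le κ]
  refine h.trans ?_
  rw [Finset.offDiag_card, sq]
  exact Nat.sub_le _ _

/-- Affine coordinates in which `a` is the origin and `b` is the first unit point. -/
theorem exists_coords {F : Type*} [Field F] {a b : F × F} (hab : a ≠ b) :
    ∃ X D : F × F → F, (∀ q r, X q = X r → D q = D r → q = r) ∧
      (∀ q, D q = 0 → q ∈ lineThrough a b) ∧
      (∀ ℓ, IsLine ℓ → a ∈ ℓ → ∀ q ∈ ℓ, ∀ r ∈ ℓ, X q * D r = X r * D q) ∧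
      (∀ ℓ, IsLine ℓ → b ∈ ℓ → ∀ q ∈ ℓ, ∀ r ∈ ℓ, (X q - 1) * D r = (X r - 1) * D q) ∧
      (∀ ℓ, IsLine ℓ → a ∉ ℓ → ∃ l : F × F, ∀ q, q ∈ ℓ ↔ l.1 * X q + l.2 * D q = X q - 1) := by
  obtain ⟨e, f, hef⟩ : ∃ e f : F, e * (b.1 - a.1) + f * (b.2 - a.2) = 1 := by
    by_cases h1 : b.1 = a.1
    · have h2 : b.2 - a.2 ≠ 0 := fun h2 => hab (Prod.ext h1.symm (sub_eq_zero.mp h2).symm)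
      exact ⟨0, (b.2 - a.2)⁻¹, by rw [zero_mul, zero_add, inv_mul_cancel₀ h2]⟩
    · exact ⟨(b.1 - a.1)⁻¹, 0, by rw [zero_mul, add_zero, inv_mul_cancel₀ (sub_ne_zero.mpr h1)]⟩
  refine ⟨fun q => e * (q.1 - a.1) + f * (q.2 - a.2),
    fun q => (b.1 - a.1) * (q.2 - a.2) - (b.2 - a.2) * (q.1 - a.1), ?_, ?_, ?_, ?_, ?_⟩
  · intro q r hX hD
    refine Prod.ext ?_ ?_
    · linear_combination (b.1 - a.1) * hX - f * hD - (q.1 - r.1) * hef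
    · linear_combination (b.2 - a.2) * hX + e * hD - (q.2 - r.2) * hef
  · intro q hq
    simp only [lineThrough, Set.mem_ofPred_eq]
    linear_combination -hq
  · intro ℓ hℓ ha q hq r hr
    by_cases h : a = q
    · subst h; simp
    · rw [hℓ.eq_lineThrough ha hq h] at hr
      simp only [lineThrough, Set.mem_ofPred_eq] at hr
      linear_combination -(e * (b.1 - a.1) + f * (b.2 - a.2)) * hr
  · intro ℓ hℓ hb q hq r hr
    by_cases h : b = q
    · subst h
      linear_combination ((b.1 - a.1) * (r.2 - a.2) - (b.2 - a.2) * (r.1 - a.1)) * hef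
    · rw [hℓ.eq_lineThrough hb hq h] at hr
      simp only [lineThrough, Set.mem_ofPred_eq] at hr
      linear_combination -(e * (b.1 - a.1) + f * (b.2 - a.2)) * hr +
        ((b.1 - a.1) * (r.2 - q.2) - (b.2 - a.2) * (r.1 - q.1)) * hef
  · intro ℓ hℓ ha
    obtain ⟨α, β, γ, h0, rfl⟩ := hℓ
    simp only [Set.mem_ofPred_eq] at ha
    have hg : γ - (α * a.1 + β * a.2) ≠ 0 := fun h => ha (sub_eq_zero.mp h).symm
    obtain ⟨g, hgg⟩ : ∃ g, g = γ - (α * a.1 + β * a.2) := ⟨_, rfl⟩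
    rw [← hgg] at hg
    refine ⟨(1 - (α * (b.1 - a.1) + β * (b.2 - a.2)) / g, -(β * e - α * f) / g), fun q => ?_⟩
    simp only [Set.mem_ofPred_eq]
    have key : ((1 - (α * (b.1 - a.1) + β * (b.2 - a.2)) / g) *
        (e * (q.1 - a.1) + f * (q.2 - a.2)) + -(β * e - α * f) / g *
          ((b.1 - a.1) * (q.2 - a.2) - (b.2 - a.2) * (q.1 - a.1)) -
        (e * (q.1 - a.1) + f * (q.2 - a.2) - 1)) * g = γ - (α * q.1 + β * q.2) := by
      field_simp
      linear_combination hgg - (α * (q.1 - a.1) + β * (q.2 - a.2)) * hef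
    constructor
    · intro h
      rw [h, sub_self] at key
      exact sub_eq_zero.mp ((mul_eq_zero.mp key).resolve_right hg)
    · intro h
      rw [h, sub_self, zero_mul] at key
      exact (sub_eq_zero.mp key.symm).symm

theorem card_filter_value_sq_le {K : Type*} [Field K] (A B : Finset K) (L : Finset (K × K)) :
    ((A ×ˢ L).filter fun y => y.2.1 * y.1 + y.2.2 ∈ B).card ^ 2 ≤ B.card * lineEnergy A L := by
  set N : K → Finset (K × K × K) := fun b => (A ×ˢ L).filter fun y => y.2.1 * y.1 + y.2.2 = b
    with hN
  have h1 : ((A ×ˢ L).filter fun y => y.2.1 * y.1 + y.2.2 ∈ B).card = ∑ b ∈ B, (N b).card := by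
    refine (Finset.card_eq_sum_card_fiberwise (f := fun y : K × K × K => y.2.1 * y.1 + y.2.2)
      (s := (A ×ˢ L).filter fun y => y.2.1 * y.1 + y.2.2 ∈ B) (t := B)
      fun y hy => (Finset.mem_filter.mp hy).2).trans ?_
    refine Finset.sum_congr rfl fun b hb => ?_
    rw [Finset.filter_filter]
    congr 1
    refine Finset.filter_congr fun y _ => ⟨fun h => h.2, fun h => ⟨h ▸ hb, h⟩⟩
  have h2 : ∑ b ∈ B, (N b).card ^ 2 ≤ lineEnergy A L := by
    calc ∑ b ∈ B, (N b).card ^ 2 = ∑ b ∈ B, (N b ×ˢ N b).card :=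
          Finset.sum_congr rfl fun b _ => by rw [Finset.card_product, sq]
      _ = (B.biUnion fun b => N b ×ˢ N b).card := by
          refine (Finset.card_biUnion ?_).symm
          intro b _ b' _ hbb
          rw [Function.onFun, Finset.disjoint_left]
          intro z hz hz'
          simp only [hN, Finset.mem_product, Finset.mem_filter] at hz hz'
          exact hbb (hz.1.2.symm.trans hz'.1.2)
      _ ≤ lineEnergy A L := by
          refine Finset.card_le_card fun z hz => ?_
          simp only [hN, Finset.mem_biUnion, Finset.mem_product, Finset.mem_filter] at hz
          obtain ⟨b, _, h1, h2⟩ := hz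
          simp only [Finset.mem_filter, Finset.mem_product]
          exact ⟨⟨h1.1, h2.1⟩, h1.2.trans h2.2.symm⟩
  rw [h1]
  exact sq_sum_le_card_mul_sum_sq.trans (Nat.mul_le_mul_left _ h2)

/-- For two points `a`, `b`: the incidences `(q, ℓ)` of a point `q` of `P` off the line `ab` with
a line `ℓ` of `L` missing `a`, such that `q` is joined to both `a` and `b` by lines of `L`. -/
noncomputable def joinedIncidences {F : Type*} [Field F] (P : Finset (F × F))
    (L : Finset (Set (F × F))) (a b : F × F) : Finset ((F × F) × Set (F × F)) :=
  (P ×ˢ L).filter fun y => y.1 ∈ y.2 ∧ a ∉ y.2 ∧ y.1 ∉ lineThrough a b ∧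
    (∃ ℓ ∈ L, a ∈ ℓ ∧ y.1 ∈ ℓ) ∧ ∃ ℓ ∈ L, b ∈ ℓ ∧ y.1 ∈ ℓ

theorem card_joinedIncidences_sq_le {F : Type*} [Field F] {P : Finset (F × F)}
    {L : Finset (Set (F × F))} {κ : ℕ} (hκ : 0 < κ) (hκP : κ ≤ P.card)
    (hL : ∀ ℓ ∈ L, IsLine ℓ) (hLκ : ∀ ℓ ∈ L, κ < (P.filter fun q => q ∈ ℓ).card)
    {v : ℝ} (hv : 0 ≤ v) (hvκ : v ^ 8 * κ = P.card)
    (hchar : ∀ i : ℕ, 0 < i → (i : ℝ) ^ 2 ≤ v ^ 24 → (i : F) ≠ 0) {a b : F × F} (hab : a ≠ b) :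
    ((joinedIncidences P L a b).card : ℝ) ^ 2 ≤ 2 * meetConst * v ^ 44 := by
  obtain ⟨X, D, hinj, hD, hXa, hXb, hdual⟩ := exists_coords hab
  set k := P.card / κ with hk
  have hk1 : 1 ≤ k := (Nat.one_le_div_iff hκ).mpr hκP
  have hκR : (0 : ℝ) < κ := by exact_mod_cast hκ
  have hkv : (k : ℝ) ≤ v ^ 8 := by
    refine Nat.cast_div_le.trans ?_
    rw [← hvκ, mul_div_cancel_right₀ _ hκR.ne']
  have hv1 : 1 ≤ v := by
    have h1 : (1 : ℝ) ≤ v ^ 8 := le_trans (by exact_mod_cast hk1) hkv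
    by_contra! h
    exact absurd h1 (not_le.mpr (pow_lt_one₀ hv h (by norm_num)))
  have hlek : ∀ {n : ℕ}, κ * n ≤ P.card → n ≤ k := fun {n} h =>
    (Nat.le_div_iff_mul_le hκ).mpr (by rwa [mul_comm])
  have hpencil : ∀ o : F × F, (L.filter fun ℓ => o ∈ ℓ).card ≤ k := by
    intro o
    refine hlek (mul_card_le_card_of_sunflower
      (fun ℓ hℓ => hLκ ℓ (Finset.mem_filter.mp hℓ).1) (o := o) ?_)
    intro ℓ hℓ ℓ' hℓ' hne q hq hq'
    rw [Finset.mem_filter] at hℓ hℓ'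
    by_contra hqo
    exact hne ((hL ℓ hℓ.1).eq_of_mem (hL ℓ' hℓ'.1) hqo hq hℓ.2 hq' hℓ'.2)
  have hslope : ∀ (Y : F × F → F) (o : F × F), (∀ ℓ, IsLine ℓ → o ∈ ℓ →
      ∀ q ∈ ℓ, ∀ r ∈ ℓ, Y q * D r = Y r * D q) → ∃ A : Finset F, A.card ≤ k ∧
      ∀ ℓ ∈ L, o ∈ ℓ → ∀ q ∈ ℓ, D q ≠ 0 → Y q / D q ∈ A := by
    intro Y o hY
    have h : ∀ ℓ : Set (F × F), ∃ c : F, ℓ ∈ L → o ∈ ℓ → ∀ q ∈ ℓ, D q ≠ 0 → Y q / D q = c := by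
      intro ℓ
      by_cases hr : ∃ r ∈ ℓ, D r ≠ 0
      · obtain ⟨r, hr, hDr⟩ := hr
        refine ⟨Y r / D r, fun hℓ ho q hq hDq => ?_⟩
        rw [div_eq_div_iff hDq hDr]
        exact hY ℓ (hL ℓ hℓ) ho q hq r hr
      · push Not at hr
        exact ⟨0, fun _ _ q hq hDq => absurd (hr q hq) hDq⟩
    choose c hc using h
    refine ⟨(L.filter fun ℓ => o ∈ ℓ).image c, Finset.card_image_le.trans (hpencil o),
      fun ℓ hℓ ho q hq hDq => ?_⟩
    rw [hc ℓ hℓ ho q hq hDq]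
    exact Finset.mem_image_of_mem _ (Finset.mem_filter.mpr ⟨hℓ, ho⟩)
  obtain ⟨A, hAk, hA⟩ := hslope X a hXa
  obtain ⟨B, hBk, hB⟩ := hslope (fun q => X q - 1) b hXb
  have hσ : ∀ ℓ : Set (F × F), ∃ l : F × F, ℓ ∈ L → a ∉ ℓ →
      ∀ q, q ∈ ℓ ↔ l.1 * X q + l.2 * D q = X q - 1 := by
    intro ℓ
    by_cases h : ℓ ∈ L ∧ a ∉ ℓ
    · obtain ⟨l, hl⟩ := hdual ℓ (hL ℓ h.1) h.2
      exact ⟨l, fun _ _ => hl⟩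
    · exact ⟨0, fun h1 h2 => absurd ⟨h1, h2⟩ h⟩
  choose σ hσ using hσ
  set L₀ := L.filter fun ℓ => a ∉ ℓ with hL₀
  have hσ' : ∀ ℓ ∈ L₀, ∀ q, q ∈ ℓ ↔ (σ ℓ).1 * X q + (σ ℓ).2 * D q = X q - 1 := fun ℓ hℓ =>
    hσ ℓ (Finset.mem_filter.mp hℓ).1 (Finset.mem_filter.mp hℓ).2
  have hσinj : ∀ ℓ ∈ L₀, ∀ ℓ' ∈ L₀, σ ℓ = σ ℓ' → ℓ = ℓ' := by
    intro ℓ hℓ ℓ' hℓ' h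
    ext q
    rw [hσ' ℓ hℓ, hσ' ℓ' hℓ', h]
  have hcol : ∀ α β γ : F, (α, β) ≠ (0, 0) →
      ((L₀.image σ).filter fun l => α * l.1 + β * l.2 = γ).card ≤ k := by
    intro α β γ h0
    rw [Finset.filter_image]
    refine Finset.card_image_le.trans (hlek ?_)
    obtain ⟨o, ho⟩ : ∃ o : F × F, ∀ q, (α - γ) * X q = α → (α - γ) * D q = β → q = o := by
      by_cases h : ∃ o, (α - γ) * X o = α ∧ (α - γ) * D o = β
      · obtain ⟨o, ho1, ho2⟩ := h
        have hαγ : α - γ ≠ 0 := by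
          intro h
          rw [h, zero_mul] at ho1 ho2
          exact h0 (by rw [← ho1, ← ho2])
        exact ⟨o, fun q h1 h2 => hinj q o (mul_left_cancel₀ hαγ (h1.trans ho1.symm))
          (mul_left_cancel₀ hαγ (h2.trans ho2.symm))⟩
      · exact ⟨a, fun q h1 h2 => absurd ⟨q, h1, h2⟩ h⟩
    refine mul_card_le_card_of_sunflower
      (fun ℓ hℓ => hLκ ℓ (Finset.mem_filter.mp (Finset.mem_filter.mp hℓ).1).1) (o := o) ?_
    intro ℓ hℓ ℓ' hℓ' hne q hq hq'
    rw [Finset.mem_filter] at hℓ hℓ'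
    rw [hσ' ℓ hℓ.1] at hq
    rw [hσ' ℓ' hℓ'.1] at hq'
    have e := hℓ.2
    have e' := hℓ'.2
    have hpar : α * D q = β * X q := by
      by_cases h1 : (σ ℓ).1 = (σ ℓ').1
      · have h2 : (σ ℓ).2 - (σ ℓ').2 ≠ 0 := fun h2 =>
          hne (hσinj ℓ hℓ.1 ℓ' hℓ'.1 (Prod.ext h1 (sub_eq_zero.mp h2)))
        refine mul_left_cancel₀ h2 ?_
        linear_combination α * (hq - hq') - X q * (e - e')
      · refine mul_left_cancel₀ (sub_ne_zero.mpr h1) ?_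
        linear_combination -β * (hq - hq') + D q * (e - e')
    refine ho q ?_ ?_
    · linear_combination X q * e - α * hq + (σ ℓ).2 * hpar
    · linear_combination D q * e - β * hq + (1 - (σ ℓ).1) * hpar
  have hLcard : ((L₀.image σ).card : ℝ) ≤ v ^ 16 := by
    have h1 : ((L₀.image σ).card : ℝ) ≤ L.card := by
      exact_mod_cast Finset.card_image_le.trans (Finset.card_filter_le _ _)
    refine h1.trans ?_
    have h2 : (κ : ℝ) ^ 2 * L.card ≤ (P.card : ℝ) ^ 2 := by
      exact_mod_cast card_mul_sq_le_card_sq hL hLκ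
    rw [← hvκ] at h2
    refine le_of_mul_le_mul_left (h2.trans (le_of_eq ?_)) (pow_pos hκR 2)
    ring
  have hE : (lineEnergy A (L₀.image σ) : ℝ) ≤ 2 * meetConst * v ^ 36 := by
    have hC : 0 ≤ meetConst := by unfold meetConst; positivity
    have hw : (v ^ 3) ^ 8 = v ^ 24 := by ring
    have h := lineEnergy_le (N := v ^ 24) hchar (w := v ^ 3) (by positivity) hw.le
      (A := A) (L := L₀.image σ) ?_ hAk hk1 hcol
    · refine h.trans ?_
      have h1 : (k : ℝ) * v ^ 3 ≤ v ^ 12 := by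
        calc (k : ℝ) * v ^ 3 ≤ v ^ 8 * v ^ 3 := by gcongr
          _ = v ^ 11 := by ring
          _ ≤ v ^ 12 := pow_le_pow_right₀ hv1 (by norm_num)
      calc meetConst * (v ^ 3) ^ 8 * ((v ^ 3) ^ 4 + k * v ^ 3)
          ≤ meetConst * (v ^ 3) ^ 8 * ((v ^ 3) ^ 4 + v ^ 12) := by gcongr
        _ = 2 * meetConst * v ^ 36 := by ring
    · calc (A.card : ℝ) * (L₀.image σ).card ≤ v ^ 8 * v ^ 16 := by
            refine mul_le_mul (le_trans (by exact_mod_cast hAk) hkv) hLcard (by positivity)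
              (by positivity)
        _ = (v ^ 3) ^ 8 := by ring
  have hG : (joinedIncidences P L a b).card ≤
      ((A ×ˢ (L₀.image σ)).filter fun y => y.2.1 * y.1 + y.2.2 ∈ B).card := by
    have hDne : ∀ q, q ∉ lineThrough a b → D q ≠ 0 := fun q hq h => hq (hD q h)
    have hval : ∀ q, ∀ ℓ ∈ L₀, D q ≠ 0 → q ∈ ℓ →
        (σ ℓ).1 * (X q / D q) + (σ ℓ).2 = (X q - 1) / D q := by
      intro q ℓ hℓ hDq hq
      rw [hσ' ℓ hℓ] at hq
      field_simp
      linear_combination hq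
    refine Finset.card_le_card_of_injOn (fun y => (X y.1 / D y.1, σ y.2)) ?_ ?_
    · rintro ⟨q, ℓ⟩ hy
      simp only [joinedIncidences, Finset.coe_filter, Finset.mem_product,
        Set.mem_ofPred_eq] at hy ⊢
      obtain ⟨⟨hqP, hℓL⟩, hqℓ, haℓ, hq, ⟨ℓ₁, hℓ₁, ha1, hq1⟩, ℓ₂, hℓ₂, hb2, hq2⟩ := hy
      have hℓ0 : ℓ ∈ L₀ := Finset.mem_filter.mpr ⟨hℓL, haℓ⟩
      refine ⟨⟨hA ℓ₁ hℓ₁ ha1 q hq1 (hDne q hq), Finset.mem_image_of_mem _ hℓ0⟩, ?_⟩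
      rw [hval q ℓ hℓ0 (hDne q hq) hqℓ]
      exact hB ℓ₂ hℓ₂ hb2 q hq2 (hDne q hq)
    · rintro ⟨q, ℓ⟩ hy ⟨q', ℓ'⟩ hy' h
      simp only [joinedIncidences, Finset.coe_filter, Finset.mem_product,
        Set.mem_ofPred_eq] at hy hy'
      simp only [Prod.mk.injEq] at h
      obtain ⟨hξ, hll⟩ := h
      have hℓ0 : ℓ ∈ L₀ := Finset.mem_filter.mpr ⟨hy.1.2, hy.2.2.1⟩
      have hℓ0' : ℓ' ∈ L₀ := Finset.mem_filter.mpr ⟨hy'.1.2, hy'.2.2.1⟩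
      have hℓℓ := hσinj ℓ hℓ0 ℓ' hℓ0' hll
      subst hℓℓ
      have hDq := hDne q hy.2.2.2.1
      have hDq' := hDne q' hy'.2.2.2.1
      have e := hval q ℓ hℓ0 hDq hy.2.1
      have e' := hval q' ℓ hℓ0 hDq' hy'.2.1
      rw [hξ, e', sub_div, sub_div, hξ] at e
      have e2 : 1 / D q' = 1 / D q := sub_right_injective e
      have hDD : D q = D q' := by
        rw [one_div, one_div] at e2
        exact (inv_injective e2).symm
      rw [hDD] at hξ
      have hXX : X q = X q' := by
        rw [div_left_inj' hDq'] at hξ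
        exact hξ
      rw [hinj q q' hXX hDD]
  have hfin : ((joinedIncidences P L a b).card : ℝ) ^ 2 ≤ k * lineEnergy A (L₀.image σ) := by
    exact_mod_cast (Nat.pow_le_pow_left hG 2).trans
      ((card_filter_value_sq_le A B (L₀.image σ)).trans (Nat.mul_le_mul_right _ hBk))
  calc ((joinedIncidences P L a b).card : ℝ) ^ 2 ≤ k * lineEnergy A (L₀.image σ) := hfin
    _ ≤ v ^ 8 * (2 * meetConst * v ^ 36) := by gcongr
    _ = 2 * meetConst * v ^ 44 := by ring

theorem sum_card_joinedIncidences_ge {F : Type*} [Field F] {P : Finset (F × F)}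
    {L : Finset (Set (F × F))} {κ : ℕ}
    (hL : ∀ ℓ ∈ L, IsLine ℓ) (hLκ : ∀ ℓ ∈ L, κ < (P.filter fun q => q ∈ ℓ).card) :
    κ ^ 2 * ∑ q ∈ P, (L.filter fun ℓ => q ∈ ℓ).card * ((L.filter fun ℓ => q ∈ ℓ).card - 1) ^ 2 ≤
      ∑ z ∈ P.offDiag, (joinedIncidences P L z.1 z.2).card := by
  set R : F × F → Finset (Set (F × F)) := fun q => L.filter fun ℓ => q ∈ ℓ with hR
  set T := P.sigma fun q => (R q).sigma fun ℓ => (R q).erase ℓ ×ˢ (R q).erase ℓ with hT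
  have hTcard : T.card = ∑ q ∈ P, (R q).card * ((R q).card - 1) ^ 2 := by
    rw [hT, Finset.card_sigma]
    refine Finset.sum_congr rfl fun q _ => ?_
    rw [Finset.card_sigma]
    rw [Finset.sum_congr rfl fun ℓ hℓ => by
      rw [Finset.card_product, Finset.card_erase_of_mem hℓ, ← sq]]
    rw [Finset.sum_const, smul_eq_mul]
  rw [← hTcard, ← Finset.card_sigma]
  refine mul_card_le_card_of_fiber (f := fun y =>
    ⟨y.2.1, lineThrough y.1.1 y.2.1, y.2.2, lineThrough y.1.2 y.2.1⟩) ?_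
  rintro ⟨q, ℓ₁, ℓ, ℓ₂⟩ hy
  simp only [hT, hR, Finset.mem_sigma, Finset.mem_product, Finset.mem_erase,
    Finset.mem_filter] at hy
  obtain ⟨hq, ⟨hℓ₁, hq₁⟩, ⟨hne, hℓ, hqℓ⟩, hne₂, hℓ₂, hq₂⟩ := hy
  have hcard : ∀ ℓ' ∈ L, κ ≤ ((P.filter fun r => r ∈ ℓ').erase q).card := by
    intro ℓ' hℓ'
    have := hLκ ℓ' hℓ'
    have := Finset.pred_card_le_card_erase (s := P.filter fun r => r ∈ ℓ') (a := q)
    omega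
  calc κ ^ 2 ≤ (((P.filter fun r => r ∈ ℓ₁).erase q) ×ˢ
        ((P.filter fun r => r ∈ ℓ₂).erase q)).card := by
        rw [Finset.card_product, sq]
        exact Nat.mul_le_mul (hcard ℓ₁ hℓ₁) (hcard ℓ₂ hℓ₂)
    _ ≤ _ := by
        refine Finset.card_le_card_of_injOn (fun z => ⟨z, (q, ℓ)⟩) ?_ ?_
        · rintro ⟨a, b⟩ hz
          simp only [Finset.coe_product, Set.mem_prod, Finset.mem_coe, Finset.mem_erase,
            Finset.mem_filter] at hz
          obtain ⟨⟨haq, ha, ha1⟩, hbq, hb, hb2⟩ := hz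
          have hab : a ≠ b := by
            rintro rfl
            exact hne₂ ((hL ℓ₂ hℓ₂).eq_of_mem (hL ℓ₁ hℓ₁) haq hb2 hq₂ ha1 hq₁)
          have e1 := (hL ℓ₁ hℓ₁).eq_lineThrough ha1 hq₁ haq
          have e2 := (hL ℓ₂ hℓ₂).eq_lineThrough hb2 hq₂ hbq
          simp only [Finset.coe_filter, Finset.mem_sigma, Set.mem_ofPred_eq, joinedIncidences,
            Finset.mem_filter, Finset.mem_product, Finset.mem_offDiag]
          refine ⟨⟨⟨ha, hb, hab⟩, ⟨hq, hℓ⟩, hqℓ, ?_, ?_, ⟨ℓ₁, hℓ₁, ha1, hq₁⟩, ℓ₂, hℓ₂, hb2, hq₂⟩,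
            ?_⟩
          · intro haℓ
            exact hne ((hL ℓ hℓ).eq_of_mem (hL ℓ₁ hℓ₁) haq haℓ hqℓ ha1 hq₁)
          · intro hqab
            refine hne₂ (Eq.trans (b := lineThrough a b) ?_ ?_)
            · exact (hL ℓ₂ hℓ₂).eq_of_mem (isLine_lineThrough hab) hbq hb2 hq₂
                (right_mem_lineThrough a b) hqab
            · exact (isLine_lineThrough hab).eq_of_mem (hL ℓ₁ hℓ₁) haq
                (left_mem_lineThrough a b) hqab ha1 hq₁
          · rw [← e1, ← e2]
        · intro z _ z' _ h
          simpa using h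

theorem card_mul_cube_le {F : Type*} [Field F] {P : Finset (F × F)}
    {L : Finset (Set (F × F))} {κ : ℕ} (hκ : 0 < κ) (hκP : κ ≤ P.card)
    (hL : ∀ ℓ ∈ L, IsLine ℓ) (hLκ : ∀ ℓ ∈ L, κ < (P.filter fun q => q ∈ ℓ).card)
    {v : ℝ} (hv : 0 ≤ v) (hvκ : v ^ 8 * κ = P.card)
    (hchar : ∀ i : ℕ, 0 < i → (i : ℝ) ^ 2 ≤ v ^ 24 → (i : F) ≠ 0) :
    ((L.card : ℝ) * κ) ^ 3 ≤
      (P.card : ℝ) ^ 2 * (4 * √(2 * meetConst) * v ^ 38 + P.card) := by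
  have hC : 0 ≤ meetConst := by unfold meetConst; positivity
  have hκR : (0 : ℝ) < κ := by exact_mod_cast hκ
  set r : F × F → ℕ := fun q => (L.filter fun ℓ => q ∈ ℓ).card with hr
  have h1 : (κ : ℝ) ^ 2 * ∑ q ∈ P, ((r q * (r q - 1) ^ 2 : ℕ) : ℝ) ≤
      (P.card : ℝ) ^ 2 * (√(2 * meetConst) * v ^ 22) := by
    have h2 : (κ : ℝ) ^ 2 * ∑ q ∈ P, ((r q * (r q - 1) ^ 2 : ℕ) : ℝ) ≤
        ∑ z ∈ P.offDiag, ((joinedIncidences P L z.1 z.2).card : ℝ) := by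
      exact_mod_cast sum_card_joinedIncidences_ge hL hLκ
    refine h2.trans ?_
    calc ∑ z ∈ P.offDiag, ((joinedIncidences P L z.1 z.2).card : ℝ)
        ≤ ∑ z ∈ P.offDiag, √(2 * meetConst) * v ^ 22 := by
          refine Finset.sum_le_sum fun z hz => ?_
          have h3 := card_joinedIncidences_sq_le hκ hκP hL hLκ hv hvκ hchar
            (Finset.mem_offDiag.mp hz).2.2
          refine le_of_sq_le_sq ?_ (by positivity)
          rw [mul_pow, Real.sq_sqrt (by positivity)]
          exact h3.trans (le_of_eq (by ring))
      _ = (P.offDiag.card : ℝ) * (√(2 * meetConst) * v ^ 22) := by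
          rw [Finset.sum_const, nsmul_eq_mul]
      _ ≤ (P.card : ℝ) ^ 2 * (√(2 * meetConst) * v ^ 22) := by
          refine mul_le_mul_of_nonneg_right ?_ (by positivity)
          rw [Finset.offDiag_card, sq]
          exact_mod_cast Nat.sub_le _ _
  have h4 : ∑ q ∈ P, ((r q * (r q - 1) ^ 2 : ℕ) : ℝ) ≤ √(2 * meetConst) * v ^ 38 := by
    refine le_of_mul_le_mul_left (h1.trans (le_of_eq ?_)) (pow_pos hκR 2)
    rw [← hvκ]
    ring
  have h5 : ∑ q ∈ P, (r q : ℝ) ^ 3 ≤ 4 * √(2 * meetConst) * v ^ 38 + P.card := by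
    have h6 : ∑ q ∈ P, (r q : ℝ) ^ 3 ≤
        ∑ q ∈ P, (4 * ((r q * (r q - 1) ^ 2 : ℕ) : ℝ) + 1) := by
      refine Finset.sum_le_sum fun q _ => ?_
      have h7 : r q ^ 3 ≤ 4 * (r q * (r q - 1) ^ 2) + 1 := by
        rcases r q with _ | _ | n
        · norm_num
        · norm_num
        · simp only [Nat.add_sub_cancel]
          nlinarith [Nat.zero_le n, Nat.zero_le (n ^ 2), Nat.zero_le (n ^ 3)]
      exact_mod_cast h7
    rw [Finset.sum_add_distrib, ← Finset.mul_sum, Finset.sum_const, nsmul_eq_mul, mul_one] at h6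
    linarith
  have h8 : (L.card : ℝ) * κ ≤ ∑ q ∈ P, (r q : ℝ) := by
    have h9 : ∑ q ∈ P, r q = ∑ ℓ ∈ L, (P.filter fun q => q ∈ ℓ).card :=
      Finset.sum_card_bipartiteAbove_eq_sum_card_bipartiteBelow (fun q ℓ => q ∈ ℓ)
    have h10 : L.card * κ ≤ ∑ q ∈ P, r q := by
      rw [h9, ← smul_eq_mul]
      exact Finset.card_nsmul_le_sum _ _ _ fun ℓ hℓ => (hLκ ℓ hℓ).le
    exact_mod_cast h10
  have h11 : (∑ q ∈ P, (r q : ℝ)) ^ 3 ≤ (P.card : ℝ) ^ 2 * ∑ q ∈ P, (r q : ℝ) ^ 3 := by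
    have hP : (0 : ℝ) < (P.card : ℝ) ^ 2 := by
      have : (0 : ℝ) < P.card := by exact_mod_cast hκ.trans_le hκP
      positivity
    rw [← div_le_iff₀' hP]
    exact pow_sum_div_card_le_sum_pow (fun q _ => Nat.cast_nonneg (r q)) 2
  calc ((L.card : ℝ) * κ) ^ 3 ≤ (∑ q ∈ P, (r q : ℝ)) ^ 3 := by gcongr
    _ ≤ (P.card : ℝ) ^ 2 * ∑ q ∈ P, (r q : ℝ) ^ 3 := h11
    _ ≤ _ := by gcongr

/-- The lines determined by `P`. -/
noncomputable def determinedLines {F : Type*} [Field F] (P : Finset (F × F)) :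
    Finset (Set (F × F)) :=
  P.offDiag.image fun z => lineThrough z.1 z.2

/-- The lines determined by `P` with more than `κ` points of `P`. -/
noncomputable def richLines {F : Type*} [Field F] (P : Finset (F × F)) (κ : ℕ) :
    Finset (Set (F × F)) :=
  (determinedLines P).filter fun ℓ => κ < (P.filter fun q => q ∈ ℓ).card

/-- The number of ordered pairs of distinct points of `P` on the line `ℓ`. -/
noncomputable def pairsOn {F : Type*} [Field F] (P : Finset (F × F)) (ℓ : Set (F × F)) : ℕ :=
  (P.filter fun q => q ∈ ℓ).card * ((P.filter fun q => q ∈ ℓ).card - 1)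

theorem isLine_of_mem_determinedLines {F : Type*} [Field F] {P : Finset (F × F)}
    {ℓ : Set (F × F)} (hℓ : ℓ ∈ determinedLines P) : IsLine ℓ := by
  obtain ⟨z, hz, rfl⟩ := Finset.mem_image.mp hℓ
  exact isLine_lineThrough (Finset.mem_offDiag.mp hz).2.2

theorem card_offDiag_le_sum_pairsOn {F : Type*} [Field F] (P : Finset (F × F)) :
    P.offDiag.card ≤ ∑ ℓ ∈ determinedLines P, pairsOn P ℓ := by
  rw [Finset.card_eq_sum_card_image (fun z : (F × F) × (F × F) => lineThrough z.1 z.2)]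
  refine Finset.sum_le_sum fun ℓ _ => ?_
  rw [pairsOn, Nat.mul_sub_one, ← Finset.offDiag_card]
  refine Finset.card_le_card ?_
  rintro ⟨q, r⟩ hz
  simp only [Finset.mem_offDiag, Finset.mem_filter] at hz ⊢
  obtain ⟨⟨hq, hr, hne⟩, rfl⟩ := hz
  exact ⟨⟨hq, left_mem_lineThrough q r⟩, ⟨hr, right_mem_lineThrough q r⟩, hne⟩

theorem sum_pairsOn_le {F : Type*} [Field F] (P : Finset (F × F)) (S : Finset (Set (F × F)))
    (κ : ℕ) : ∑ ℓ ∈ S, pairsOn P ℓ ≤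
      ∑ ℓ ∈ S.filter (fun ℓ => κ < (P.filter fun q => q ∈ ℓ).card), pairsOn P ℓ +
        S.card * κ ^ 2 := by
  rw [← Finset.sum_filter_add_sum_filter_not S
    (fun ℓ => κ < (P.filter fun q => q ∈ ℓ).card) (pairsOn P)]
  refine Nat.add_le_add_left ?_ _
  calc _ ≤ ∑ ℓ ∈ S.filter (fun ℓ => ¬ κ < (P.filter fun q => q ∈ ℓ).card), κ ^ 2 := by
        refine Finset.sum_le_sum fun ℓ hℓ => ?_
        have h := not_lt.mp (Finset.mem_filter.mp hℓ).2
        rw [pairsOn, sq]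
        exact Nat.mul_le_mul h ((Nat.sub_le _ _).trans h)
    _ ≤ S.card * κ ^ 2 := by
        rw [Finset.sum_const, smul_eq_mul]
        exact Nat.mul_le_mul_right _ (Finset.card_filter_le _ _)

/-- The constant in the bound for the number of rich lines. -/
noncomputable def richConst : ℝ := 4 * √(2 * meetConst) + 1

theorem one_le_richConst : 1 ≤ richConst := by
  unfold richConst
  linarith [Real.sqrt_nonneg (2 * meetConst)]

theorem card_richLines_mul_sq_le {F : Type*} [Field F] {P : Finset (F × F)} {κ : ℕ} (hκ : 0 < κ)
    (hchar : ∀ i : ℕ, 0 < i → (i : ℝ) ^ 2 * κ ^ 3 ≤ (P.card : ℝ) ^ 3 → (i : F) ≠ 0)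
    {g : ℝ} (hg : 0 ≤ g) (hgκ : g ^ 12 * κ ^ 7 = (P.card : ℝ) ^ 3) :
    ((richLines P κ).card : ℝ) * κ ^ 2 ≤ richConst * P.card ^ 2 * g + P.card * κ := by
  have hκR : (0 : ℝ) < κ := by exact_mod_cast hκ
  have hC := one_le_richConst
  by_cases hκP : κ ≤ P.card
  swap
  · have h0 : richLines P κ = ∅ := by
      refine Finset.filter_eq_empty_iff.mpr fun ℓ _ => ?_
      have := Finset.card_filter_le P fun q => q ∈ ℓ
      omega
    rw [h0, Finset.card_empty, Nat.cast_zero, zero_mul]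
    positivity
  obtain ⟨v, hv, hv8⟩ : ∃ v : ℝ, 0 ≤ v ∧ v ^ 8 * κ = P.card :=
    ⟨((P.card : ℝ) / κ) ^ (((8 : ℕ) : ℝ)⁻¹), by positivity, by
      rw [Real.rpow_inv_natCast_pow (by positivity) (by norm_num), div_mul_cancel₀ _ hκR.ne']⟩
  have hP : (0 : ℝ) < P.card := by exact_mod_cast hκ.trans_le hκP
  have h := card_mul_cube_le hκ hκP
    (fun ℓ hℓ => isLine_of_mem_determinedLines (Finset.mem_filter.mp hℓ).1)
    (fun ℓ hℓ => (Finset.mem_filter.mp hℓ).2) (L := richLines P κ) hv hv8 (by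
      intro i hi hiv
      refine hchar i hi ?_
      calc (i : ℝ) ^ 2 * κ ^ 3 ≤ v ^ 24 * κ ^ 3 := by gcongr
        _ = (v ^ 8 * κ) ^ 3 := by ring
        _ = _ := by rw [hv8])
  have hgv : g ^ 3 * P.card = v ^ 14 := by
    refine (pow_left_inj₀ (by positivity) (by positivity) (n := 4) (by norm_num)).mp ?_
    have h7 : (0 : ℝ) < (κ : ℝ) ^ 7 := by positivity
    refine mul_right_cancel₀ h7.ne' ?_
    calc (g ^ 3 * (P.card : ℝ)) ^ 4 * κ ^ 7 = (g ^ 12 * κ ^ 7) * (P.card : ℝ) ^ 4 := by ring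
      _ = (P.card : ℝ) ^ 7 := by rw [hgκ]; ring
      _ = (v ^ 8 * κ) ^ 7 := by rw [hv8]
      _ = (v ^ 14) ^ 4 * κ ^ 7 := by ring
  set C := richConst with hCdef
  have hx : C * v ^ 8 * P.card * g + P.card ≥ (richLines P κ).card * κ := by
    refine le_of_pow_le_pow_left₀ (n := 3) (by norm_num) (by positivity) (h.trans ?_)
    have h1 : 4 * √(2 * meetConst) ≤ C ^ 3 := by
      have : C ≤ C ^ 3 := le_self_pow₀ hC (by norm_num)
      have h2 : 4 * √(2 * meetConst) + 1 = C := rfl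
      linarith
    have h3 : 0 ≤ C * v ^ 8 * P.card * g := by positivity
    calc (P.card : ℝ) ^ 2 * (4 * √(2 * meetConst) * v ^ 38 + P.card)
        ≤ (P.card : ℝ) ^ 2 * (C ^ 3 * v ^ 38 + P.card) := by gcongr
      _ = C ^ 3 * v ^ 24 * (P.card : ℝ) ^ 2 * v ^ 14 + (P.card : ℝ) ^ 3 := by ring
      _ = (C * v ^ 8 * P.card * g) ^ 3 + (P.card : ℝ) ^ 3 := by rw [← hgv]; ring
      _ ≤ (C * v ^ 8 * P.card * g + P.card) ^ 3 := by
          nlinarith [mul_nonneg h3 hP.le, mul_nonneg (mul_nonneg h3 hP.le) h3,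
            mul_nonneg (mul_nonneg h3 hP.le) hP.le]
  calc ((richLines P κ).card : ℝ) * κ ^ 2 = (richLines P κ).card * κ * κ := by ring
    _ ≤ (C * v ^ 8 * P.card * g + P.card) * κ := by gcongr
    _ = C * P.card * (v ^ 8 * κ) * g + P.card * κ := by ring
    _ = C * P.card ^ 2 * g + P.card * κ := by rw [hv8]; ring

theorem sum_pairsOn_richLines_le {F : Type*} [Field F] {P : Finset (F × F)} {β : ℝ}
    (hβ : ∀ ℓ ∈ determinedLines P, ((P.filter fun q => q ∈ ℓ).card : ℝ) < β * P.card)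
    {g : ℕ → ℝ} (hg : ∀ κ, 0 ≤ g κ) (hgκ : ∀ κ, 0 < κ → g κ ^ 12 * κ ^ 7 = (P.card : ℝ) ^ 3)
    (n : ℕ) : ∀ κ : ℕ, 0 < κ → P.card ≤ κ + n → (κ : ℝ) ≤ 2 * β * P.card →
    (∀ i : ℕ, 0 < i → (i : ℝ) ^ 2 * κ ^ 3 ≤ (P.card : ℝ) ^ 3 → (i : F) ≠ 0) →
    ((∑ ℓ ∈ richLines P κ, pairsOn P ℓ : ℕ) : ℝ) ≤
      16 * richConst * P.card ^ 2 * g κ + P.card * (8 * β * P.card - 4 * κ) := by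
  have hC := one_le_richConst
  have hempty : ∀ κ : ℕ, (κ : ℝ) ≤ 2 * β * P.card → richLines P κ = ∅ →
      ((∑ ℓ ∈ richLines P κ, pairsOn P ℓ : ℕ) : ℝ) ≤
        16 * richConst * P.card ^ 2 * g κ + P.card * (8 * β * P.card - 4 * κ) := by
    intro κ hκβ h
    rw [h, Finset.sum_empty, Nat.cast_zero]
    have h1 := hg κ
    have h2 : 0 ≤ 8 * β * P.card - 4 * κ := by linarith
    positivity
  induction n with
  | zero =>
    intro κ hκ hn hκβ _
    refine hempty κ hκβ (Finset.filter_eq_empty_iff.mpr fun ℓ _ => ?_)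
    have := Finset.card_filter_le P fun q => q ∈ ℓ
    omega
  | succ n ih =>
    intro κ hκ hn hκβ hchar
    by_cases hb : β * P.card ≤ κ
    · refine hempty κ hκβ (Finset.filter_eq_empty_iff.mpr fun ℓ hℓ h => ?_)
      have h1 := hβ ℓ hℓ
      have h2 : (κ : ℝ) < (P.filter fun q => q ∈ ℓ).card := by exact_mod_cast h
      linarith
    · push Not at hb
      have hκR : (0 : ℝ) < κ := by exact_mod_cast hκ
      have h2 := ih (2 * κ) (by omega) (by omega) (by push_cast; linarith) (by
        intro i hi h
        refine hchar i hi (le_trans ?_ h)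
        push_cast
        gcongr
        linarith)
      have hlev := card_richLines_mul_sq_le hκ hchar (hg κ) (hgκ κ hκ)
      have hg2 : g (2 * κ) ≤ 3 / 4 * g κ := by
        refine le_of_pow_le_pow_left₀ (n := 12) (by norm_num)
          (mul_nonneg (by norm_num) (hg κ)) ?_
        have e1 := hgκ κ hκ
        have e2 := hgκ (2 * κ) (by omega)
        have h7 : (0 : ℝ) < (κ : ℝ) ^ 7 := by positivity
        have e3 : 128 * g (2 * κ) ^ 12 = g κ ^ 12 := by
          refine mul_right_cancel₀ h7.ne' ?_
          rw [e1, ← e2]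
          push_cast
          ring
        rw [mul_pow, ← e3]
        have h12 : 0 ≤ g (2 * κ) ^ 12 := pow_nonneg (hg _) _
        norm_num
        linarith
      have hsum := sum_pairsOn_le P (richLines P κ) (2 * κ)
      have hsub : (richLines P κ).filter (fun ℓ => 2 * κ < (P.filter fun q => q ∈ ℓ).card) ⊆
          richLines P (2 * κ) := by
        intro ℓ hℓ
        rw [Finset.mem_filter] at hℓ
        exact Finset.mem_filter.mpr ⟨(Finset.mem_filter.mp hℓ.1).1, hℓ.2⟩
      have hsum2 : ((∑ ℓ ∈ richLines P κ, pairsOn P ℓ : ℕ) : ℝ) ≤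
          ((∑ ℓ ∈ richLines P (2 * κ), pairsOn P ℓ : ℕ) : ℝ) +
            4 * ((richLines P κ).card * (κ : ℝ) ^ 2) := by
        have h3 := hsum.trans (Nat.add_le_add_right (Finset.sum_le_sum_of_subset hsub) _)
        refine le_trans (Nat.cast_le.mpr h3) (le_of_eq ?_)
        push_cast
        ring
      push_cast at h2
      have h5 : 16 * richConst * (P.card : ℝ) ^ 2 * g (2 * κ) ≤
          16 * richConst * (P.card : ℝ) ^ 2 * (3 / 4 * g κ) := by gcongr
      push_cast at hsum2 ⊢
      linarith

/-- The ratio to `(P.card) ^ (3 / 7)` from which lines count as rich. -/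
noncomputable def richThreshold : ℝ := (128 * richConst) ^ 2

theorem card_determinedLines_ge {F : Type*} [Field F] {P : Finset (F × F)} (hP : 2 ≤ P.card)
    {u : ℝ} (hu : 0 ≤ u) (hu7 : u ^ 7 = P.card)
    (hchar : ∀ i : ℕ, 0 < i → richThreshold ^ 3 * (i : ℝ) ^ 2 ≤ u ^ 12 → (i : F) ≠ 0)
    (hβ : ∀ ℓ ∈ determinedLines P, ((P.filter fun q => q ∈ ℓ).card : ℝ) < 1 / 64 * P.card) :
    1 / (16 * richThreshold ^ 2) * u ^ 8 ≤ (determinedLines P).card := by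
  have hC := one_le_richConst
  set c := richThreshold with hc
  have hc1 : 1 ≤ c := by
    rw [hc, richThreshold]
    exact one_le_pow₀ (by linarith)
  have hP2 : (2 : ℝ) ≤ P.card := by exact_mod_cast hP
  have hu1 : 1 ≤ u := by
    by_contra! h
    have := pow_lt_one₀ hu h (n := 7) (by norm_num)
    linarith
  have hu0 : 0 < u := by linarith
  set κ := ⌈c * u ^ 3⌉₊ with hκdef
  have hκlow : c * u ^ 3 ≤ κ := Nat.le_ceil _
  have hone : 1 ≤ c * u ^ 3 := one_le_mul_of_one_le_of_one_le hc1 (one_le_pow₀ hu1)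
  have hκup : (κ : ℝ) ≤ 2 * (c * u ^ 3) := by
    have := Nat.ceil_lt_add_one (a := c * u ^ 3) (by positivity)
    linarith
  have hκ : 0 < κ := Nat.ceil_pos.mpr (by linarith)
  have hκR : (0 : ℝ) < κ := by exact_mod_cast hκ
  have hS : ((∑ ℓ ∈ richLines P κ, pairsOn P ℓ : ℕ) : ℝ) ≤ (P.card : ℝ) ^ 2 / 4 := by
    by_cases hκβ : (κ : ℝ) ≤ 2 * (1 / 64) * P.card
    · set g : ℕ → ℝ := fun i => ((P.card : ℝ) ^ 3 / i ^ 7) ^ (((12 : ℕ) : ℝ)⁻¹) with hgdef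
      have hg : ∀ i, 0 ≤ g i := fun i => by simp only [hgdef]; positivity
      have hgi : ∀ i : ℕ, 0 < i → g i ^ 12 * i ^ 7 = (P.card : ℝ) ^ 3 := by
        intro i hi
        have hi0 : (0 : ℝ) < (i : ℝ) ^ 7 := pow_pos (by exact_mod_cast hi) 7
        simp only [hgdef]
        rw [Real.rpow_inv_natCast_pow (by positivity) (by norm_num), div_mul_cancel₀ _ hi0.ne']
      have h := sum_pairsOn_richLines_le hβ hg hgi P.card κ hκ (by omega) hκβ (by
        intro i hi h
        refine hchar i hi ?_
        refine le_of_mul_le_mul_right ?_ (pow_pos hu0 9)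
        calc c ^ 3 * (i : ℝ) ^ 2 * u ^ 9 = (i : ℝ) ^ 2 * (c * u ^ 3) ^ 3 := by ring
          _ ≤ (i : ℝ) ^ 2 * κ ^ 3 := by gcongr
          _ ≤ (P.card : ℝ) ^ 3 := h
          _ = u ^ 12 * u ^ 9 := by rw [← hu7]; ring)
      have hgκ : 128 * richConst * g κ ≤ 1 := by
        refine (pow_le_one_iff_of_nonneg (by have := hg κ; positivity)
          (n := 12) (by norm_num)).mp ?_
        refine le_of_mul_le_mul_right ?_ (pow_pos hκR 7)
        calc (128 * richConst * g κ) ^ 12 * (κ : ℝ) ^ 7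
            = (128 * richConst) ^ 12 * (g κ ^ 12 * κ ^ 7) := by ring
          _ = c ^ 6 * u ^ 21 := by rw [hgi κ hκ, ← hu7, hc, richThreshold]; ring
          _ ≤ c ^ 7 * u ^ 21 := by
              gcongr
              norm_num
          _ = (c * u ^ 3) ^ 7 := by ring
          _ ≤ 1 * (κ : ℝ) ^ 7 := by rw [one_mul]; gcongr
      have h1 : 16 * richConst * (P.card : ℝ) ^ 2 * g κ ≤ (P.card : ℝ) ^ 2 / 8 := by
        calc 16 * richConst * (P.card : ℝ) ^ 2 * g κ
            = (P.card : ℝ) ^ 2 / 8 * (128 * richConst * g κ) := by ring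
          _ ≤ (P.card : ℝ) ^ 2 / 8 * 1 := by gcongr
          _ = _ := mul_one _
      have h2 : 0 ≤ (P.card : ℝ) * κ := by positivity
      linarith
    · have h0 : richLines P κ = ∅ := by
        refine Finset.filter_eq_empty_iff.mpr fun ℓ hℓ h => ?_
        have h1 := hβ ℓ hℓ
        have h2 : (κ : ℝ) < (P.filter fun q => q ∈ ℓ).card := by exact_mod_cast h
        linarith
      rw [h0, Finset.sum_empty, Nat.cast_zero]
      positivity
  have htot : (P.card : ℝ) ^ 2 ≤ 4 * ((determinedLines P).card * (κ : ℝ) ^ 2) := by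
    have h1 : (P.card : ℝ) ^ 2 - P.card ≤
        ((∑ ℓ ∈ richLines P κ, pairsOn P ℓ : ℕ) : ℝ) + (determinedLines P).card * (κ : ℝ) ^ 2 := by
      have h2 := (card_offDiag_le_sum_pairsOn P).trans (sum_pairsOn_le P (determinedLines P) κ)
      have h3 : (P.offDiag.card : ℝ) = (P.card : ℝ) ^ 2 - P.card := by
        rw [Finset.offDiag_card, Nat.cast_sub (Nat.le_mul_self _)]
        push_cast
        ring
      rw [← h3]
      exact_mod_cast h2
    nlinarith
  have hκ2 : (κ : ℝ) ^ 2 ≤ 4 * c ^ 2 * u ^ 6 := by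
    calc (κ : ℝ) ^ 2 ≤ (2 * (c * u ^ 3)) ^ 2 := by gcongr
      _ = 4 * c ^ 2 * u ^ 6 := by ring
  rw [one_div, inv_mul_le_iff₀ (by positivity)]
  refine le_of_mul_le_mul_right ?_ (pow_pos hu0 6)
  calc u ^ 8 * u ^ 6 = (P.card : ℝ) ^ 2 := by rw [← hu7]; ring
    _ ≤ 4 * ((determinedLines P).card * (κ : ℝ) ^ 2) := htot
    _ ≤ 4 * ((determinedLines P).card * (4 * c ^ 2 * u ^ 6)) := by gcongr
    _ = _ := by ring

theorem natCast_ne_zero_of_sq_lt {F : Type*} [Field F] {m : ℕ}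
    (h : ∀ p : ℕ, p.Prime → CharP F p → (m : ℝ) ≤ 1 * (p : ℝ) ^ ((7 : ℝ) / 6)) {u : ℝ}
    (hu : 0 ≤ u) (hu7 : u ^ 7 = m) {i : ℕ} (hi : 0 < i) (hiu : (i : ℝ) ^ 2 < u ^ 12) :
    (i : F) ≠ 0 := by
  obtain ⟨p, hp⟩ := CharP.exists F
  rw [Ne, CharP.cast_eq_zero_iff F p]
  intro hdvd
  rcases CharP.char_is_prime_or_zero F p with hpr | rfl
  · have hpi : (p : ℝ) ≤ i := by exact_mod_cast Nat.le_of_dvd hi hdvd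
    have hm := h p hpr hp
    set t := (p : ℝ) ^ ((1 : ℝ) / 6) with ht
    have ht0 : 0 ≤ t := by positivity
    have ht6 : t ^ 6 = p := by
      rw [ht, ← Real.rpow_natCast, ← Real.rpow_mul (Nat.cast_nonneg p)]
      norm_num
    have ht7 : (p : ℝ) ^ ((7 : ℝ) / 6) = t ^ 7 := by
      rw [ht, ← Real.rpow_natCast, ← Real.rpow_mul (Nat.cast_nonneg p)]
      norm_num
    rw [one_mul, ht7, ← hu7] at hm
    have hut : u ≤ t := le_of_pow_le_pow_left₀ (by norm_num) ht0 hm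
    have h1 : u ^ 12 ≤ (i : ℝ) ^ 2 := by
      calc u ^ 12 ≤ t ^ 12 := by gcongr
        _ = (p : ℝ) ^ 2 := by rw [← ht6]; ring
        _ ≤ (i : ℝ) ^ 2 := by gcongr
    linarith
  · exact hi.ne' (Nat.eq_zero_of_zero_dvd hdvd)

theorem setOf_determined_eq {F : Type*} [Field F] (P : Finset (F × F)) :
    {ℓ : Set (F × F) | IsLine ℓ ∧ ∃ q ∈ P, ∃ r ∈ P, q ≠ r ∧ q ∈ ℓ ∧ r ∈ ℓ} =
      determinedLines P := by
  ext ℓ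
  simp only [Set.mem_ofPred_eq, determinedLines, Finset.coe_image, Set.mem_image, Finset.mem_coe,
    Finset.mem_offDiag]
  constructor
  · rintro ⟨hℓ, q, hq, r, hr, hne, hqℓ, hrℓ⟩
    exact ⟨(q, r), ⟨hq, hr, hne⟩, (hℓ.eq_lineThrough hqℓ hrℓ hne).symm⟩
  · rintro ⟨⟨q, r⟩, ⟨hq, hr, hne⟩, rfl⟩
    exact ⟨isLine_lineThrough hne, q, hq, r, hr, hne, left_mem_lineThrough q r,
      right_mem_lineThrough q r⟩

theorem stmt_14 :
    ∃ c β γ : ℝ, 0 < c ∧ 0 < β ∧ 0 < γ ∧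
      ∀ (F : Type) [Field F] (P : Finset (F × F)) (m : ℕ), P.card = m →
        (∀ p : ℕ, p.Prime → CharP F p → (m : ℝ) ≤ c * (p : ℝ) ^ ((7 : ℝ) / 6)) →
        (∃ ℓ : Set (F × F), IsLine ℓ ∧
            β * (m : ℝ) ≤ (Set.ncard {q : F × F | q ∈ P ∧ q ∈ ℓ} : ℝ)) ∨
          γ * (m : ℝ) ^ ((8 : ℝ) / 7) ≤
            (Set.ncard {ℓ : Set (F × F) | IsLine ℓ ∧
              ∃ q ∈ P, ∃ r ∈ P, q ≠ r ∧ q ∈ ℓ ∧ r ∈ ℓ} : ℝ) := by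
  have hc1 : 1 < richThreshold := one_lt_pow₀ (by linarith [one_le_richConst]) (by norm_num)
  refine ⟨1, 1 / 64, 1 / (16 * richThreshold ^ 2), one_pos, by norm_num, by positivity, ?_⟩
  rintro F _ P m rfl hp
  have hncard : ∀ ℓ : Set (F × F),
      Set.ncard {q : F × F | q ∈ P ∧ q ∈ ℓ} = (P.filter fun q => q ∈ ℓ).card := by
    intro ℓ
    rw [← Set.ncard_coe_finset, Finset.coe_filter]
  by_cases hex : ∃ ℓ : Set (F × F), IsLine ℓ ∧
      1 / 64 * (P.card : ℝ) ≤ (Set.ncard {q : F × F | q ∈ P ∧ q ∈ ℓ} : ℝ)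
  · exact Or.inl hex
  refine Or.inr ?_
  have hβ : ∀ ℓ, IsLine ℓ → ((P.filter fun q => q ∈ ℓ).card : ℝ) < 1 / 64 * P.card := by
    intro ℓ hℓ
    rw [← hncard]
    exact not_le.mp fun h => hex ⟨ℓ, hℓ, h⟩
  have hP : 2 ≤ P.card := by
    by_contra! h
    obtain ⟨q, hq⟩ := Finset.card_le_one_iff_subset_singleton.mp (Nat.le_of_lt_succ h)
    have h1 := hβ {z | 1 * z.1 + 0 * z.2 = q.1} ⟨1, 0, q.1, by simp, rfl⟩
    rw [Finset.filter_true_of_mem fun z hz => by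
      simp [Finset.mem_singleton.mp (hq hz)]] at h1
    have : (0 : ℝ) ≤ P.card := Nat.cast_nonneg _
    linarith
  set u := (P.card : ℝ) ^ ((1 : ℝ) / 7) with hu
  have hu0 : 0 < u := Real.rpow_pos_of_pos (by exact_mod_cast (by omega : 0 < P.card)) _
  have hu7 : u ^ 7 = P.card := by
    rw [hu, ← Real.rpow_natCast, ← Real.rpow_mul (Nat.cast_nonneg _)]
    norm_num
  have hu8 : (P.card : ℝ) ^ ((8 : ℝ) / 7) = u ^ 8 := by
    rw [hu, ← Real.rpow_natCast, ← Real.rpow_mul (Nat.cast_nonneg _)]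
    norm_num
  rw [setOf_determined_eq, Set.ncard_coe_finset, hu8]
  refine card_determinedLines_ge hP hu0.le hu7 (fun i hi hiu => ?_)
    fun ℓ hℓ => hβ ℓ (isLine_of_mem_determinedLines hℓ)
  refine natCast_ne_zero_of_sq_lt hp hu0.le hu7 hi (lt_of_lt_of_le ?_ hiu)
  have hi2 : (0 : ℝ) < (i : ℝ) ^ 2 := pow_pos (by exact_mod_cast hi) 2
  exact lt_mul_left hi2 (one_lt_pow₀ hc1 (by norm_num))
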